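/- For all σ ∈ (0,1], all a ∈ Sⁿ, and all t ≥ ln((2d+1)·n/σ), the probability under ν_{a,σ} that ln C(z) > t is at most (13·d·n/σ)·e^{-t}. -/

import Mathlib

open MeasureTheory
open scoped RealInnerProductSpace

/-- The spherical cap `{z ∈ Sⁿ : ⟨z,a⟩ > √(1-ρ²)}` in `Sⁿ ⊆ ℝ^{n+1}`. -/
noncomputable def cap (n : ℕ) (a : EuclideanSpace ℝ (Fin (n + 1))) (ρ : ℝ) :
    Set (EuclideanSpace ℝ (Fin (n + 1))) :=
  {z | z ∈ Metric.sphere (0 : EuclideanSpace ℝ (Fin (n + 1))) 1 ∧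
       Real.sqrt (1 - ρ ^ 2) < ⟪z, a⟫}

/-- `ν_{a,σ}`: the uniform probability measure on `cap(a,σ)`, i.e. the normalized
`n`-dimensional Hausdorff (surface) measure restricted to `cap(a,σ)`. -/
noncomputable def nuMeasure (n : ℕ) (a : EuclideanSpace ℝ (Fin (n + 1))) (σ : ℝ) :
    Measure (EuclideanSpace ℝ (Fin (n + 1))) :=
  (μH[(n : ℝ)] (cap n a σ))⁻¹ • (μH[(n : ℝ)]).restrict (cap n a σ)

namespace ConicCondition
open Set Real
open scoped ENNReal

section Gaussian

/-- The Gaussian density `exp (-π ‖x‖²)` as an extended nonnegative function. -/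
noncomputable def gaussDensity {E : Type*} [Norm E] (x : E) : ℝ≥0∞ :=
  ENNReal.ofReal (rexp (-π * ‖x‖ ^ 2))

lemma measurable_gaussDensity {E : Type*} [NormedAddCommGroup E] [MeasurableSpace E]
    [BorelSpace E] : Measurable (gaussDensity : E → ℝ≥0∞) := by
  unfold gaussDensity
  fun_prop

/-- The Gaussian probability measure with density `exp (-π ‖x‖²)`. -/
noncomputable def gauss (E : Type*) [NormedAddCommGroup E] [InnerProductSpace ℝ E]
    [FiniteDimensional ℝ E] [MeasurableSpace E] [BorelSpace E] : Measure E :=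
  volume.withDensity gaussDensity

variable {E : Type*} [NormedAddCommGroup E] [InnerProductSpace ℝ E]
    [FiniteDimensional ℝ E] [MeasurableSpace E] [BorelSpace E]

lemma lintegral_exp_neg_mul_sq_norm {b : ℝ} (hb : 0 < b) :
    ∫⁻ x : E, ENNReal.ofReal (rexp (-b * ‖x‖ ^ 2)) =
      ENNReal.ofReal ((π / b) ^ (Module.finrank ℝ E / 2 : ℝ)) := by
  rw [← GaussianFourier.integral_rexp_neg_mul_sq_norm hb, ofReal_integral_eq_lintegral_ofReal]
  · refine Integrable.of_integral_ne_zero ?_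
    rw [GaussianFourier.integral_rexp_neg_mul_sq_norm hb]
    positivity
  · exact Filter.Eventually.of_forall fun x => (Real.exp_pos _).le

lemma lintegral_gauss {f : E → ℝ≥0∞} :
    ∫⁻ x, f x ∂gauss E = ∫⁻ x, gaussDensity x * f x := by
  rw [gauss, lintegral_withDensity_eq_lintegral_mul_non_measurable _ measurable_gaussDensity]
  · rfl
  · exact Filter.Eventually.of_forall fun x => ENNReal.ofReal_lt_top

lemma lintegral_gaussDensity : ∫⁻ x : E, gaussDensity x = 1 := by
  unfold gaussDensity
  rw [lintegral_exp_neg_mul_sq_norm Real.pi_pos, div_self Real.pi_ne_zero]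
  simp

instance : IsProbabilityMeasure (gauss E) := by
  constructor
  rw [gauss, withDensity_apply _ MeasurableSet.univ, Measure.restrict_univ]
  exact lintegral_gaussDensity

lemma gauss_absolutelyContinuous : gauss E ≪ volume := withDensity_absolutelyContinuous _ _

lemma lintegral_gauss_exp {c : ℝ} (hc : 0 ≤ c) :
    ∫⁻ x : E, ENNReal.ofReal (rexp (-(π * c) * ‖x‖ ^ 2)) ∂gauss E =
      ENNReal.ofReal ((1 + c)⁻¹ ^ (Module.finrank ℝ E / 2 : ℝ)) := by
  have h : ∀ x : E, gaussDensity x * ENNReal.ofReal (rexp (-(π * c) * ‖x‖ ^ 2)) =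
      ENNReal.ofReal (rexp (-(π * (1 + c)) * ‖x‖ ^ 2)) := fun x => by
    rw [gaussDensity, ← ENNReal.ofReal_mul (Real.exp_pos _).le, ← Real.exp_add]
    congr 2; ring
  rw [lintegral_gauss, lintegral_congr h, lintegral_exp_neg_mul_sq_norm (by positivity)]
  congr 2
  field_simp

/-- A linear isomorphism under which normalized densities correspond is measure preserving for the
associated probability measures. -/
lemma measurePreserving_withDensity_of_linear {V W : Type*}
    [NormedAddCommGroup V] [NormedSpace ℝ V] [FiniteDimensional ℝ V] [MeasurableSpace V]
    [BorelSpace V]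
    [NormedAddCommGroup W] [NormedSpace ℝ W] [FiniteDimensional ℝ W] [MeasurableSpace W]
    [BorelSpace W]
    (μ : Measure V) [μ.IsAddHaarMeasure] (ν : Measure W) [ν.IsAddHaarMeasure] (Ψ : V ≃L[ℝ] W)
    {f : W → ℝ≥0∞} (hf : Measurable f) (h1 : ∫⁻ v, f (Ψ v) ∂μ = 1) (h2 : ∫⁻ w, f w ∂ν = 1) :
    MeasurePreserving Ψ (μ.withDensity (fun v => f (Ψ v))) (ν.withDensity f) := by
  have hm : Measurable Ψ := Ψ.continuous.measurable
  obtain h := Measure.isAddLeftInvariant_eq_smul (μ.map Ψ) ν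
  set c := (μ.map Ψ).addHaarScalarFactor ν
  have hc : (c : ℝ≥0∞) = 1 := by
    have : ∫⁻ w, f w ∂(μ.map Ψ) = 1 := by rw [lintegral_map hf hm, h1]
    rw [h, lintegral_smul_measure, h2] at this
    simpa [ENNReal.smul_def] using this
  have hc' : c = 1 := by exact_mod_cast hc
  rw [hc', one_smul] at h
  refine ⟨hm, ?_⟩
  ext s hs
  rw [Measure.map_apply hm hs, withDensity_apply _ (hm hs), withDensity_apply _ hs, ← h,
    setLIntegral_map hs hf hm]

lemma gauss_prod_eq {F : Type*} [NormedAddCommGroup F] [InnerProductSpace ℝ F]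
    [FiniteDimensional ℝ F] [MeasurableSpace F] [BorelSpace F] :
    (gauss E).prod (gauss F) =
      ((volume : Measure E).prod (volume : Measure F)).withDensity
        (fun p => gaussDensity p.1 * gaussDensity p.2) := by
  rw [gauss, gauss, prod_withDensity measurable_gaussDensity measurable_gaussDensity]

/-- Splitting a Gaussian vector along a unit vector and its orthogonal complement. -/
lemma exists_split {m : ℕ} (hE : Module.finrank ℝ E = m + 1) {u : E} (hu : ‖u‖ = 1) :
    ∃ ι : EuclideanSpace ℝ (Fin m) →ₗᵢ[ℝ] E, (∀ w, ⟪u, ι w⟫ = 0) ∧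
      MeasurePreserving (fun p : ℝ × EuclideanSpace ℝ (Fin m) => p.1 • u + ι p.2)
        ((gauss ℝ).prod (gauss (EuclideanSpace ℝ (Fin m)))) (gauss E) := by
  have hu0 : u ≠ 0 := by rintro rfl; simp at hu
  have : Fact (Module.finrank ℝ E = m + 1) := ⟨hE⟩
  have hK : Module.finrank ℝ (ℝ ∙ u)ᗮ = m := Submodule.finrank_orthogonal_span_singleton hu0
  let b : OrthonormalBasis (Fin m) ℝ (ℝ ∙ u)ᗮ := (stdOrthonormalBasis ℝ _).reindex (finCongr hK)
  let ι : EuclideanSpace ℝ (Fin m) →ₗᵢ[ℝ] E :=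
    (ℝ ∙ u)ᗮ.subtypeₗᵢ.comp b.repr.symm.toLinearIsometry
  have hι : ∀ w, ⟪u, ι w⟫ = 0 := fun w =>
    (Submodule.mem_orthogonal_singleton_iff_inner_right.1 (b.repr.symm w).2)
  have hnorm : ∀ (c : ℝ) (w : EuclideanSpace ℝ (Fin m)),
      ‖c • u + ι w‖ ^ 2 = ‖c‖ ^ 2 + ‖w‖ ^ 2 := fun c w => by
    have := norm_add_sq_eq_norm_sq_add_norm_sq_real (x := c • u) (y := ι w)
      (by rw [inner_smul_left, hι]; simp)
    rw [norm_smul, hu, mul_one, ι.norm_map] at this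
    nlinarith [this]
  refine ⟨ι, hι, ?_⟩
  let Ψ0 : ℝ × EuclideanSpace ℝ (Fin m) →ₗ[ℝ] E :=
    (LinearMap.toSpanSingleton ℝ E u).coprod ι.toLinearMap
  have hΨ0 : ∀ p, Ψ0 p = p.1 • u + ι p.2 := fun p => by simp [Ψ0]
  have hinj : Function.Injective Ψ0 := by
    rw [← LinearMap.ker_eq_bot, LinearMap.ker_eq_bot']
    intro p hp
    have h := hnorm p.1 p.2
    rw [← hΨ0, hp, norm_zero] at h
    have h1 : ‖p.1‖ = 0 := by nlinarith [sq_nonneg ‖p.1‖, sq_nonneg ‖p.2‖]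
    have h2 : ‖p.2‖ = 0 := by nlinarith [sq_nonneg ‖p.1‖, sq_nonneg ‖p.2‖]
    exact Prod.ext (norm_eq_zero.1 h1) (norm_eq_zero.1 h2)
  let Ψ : (ℝ × EuclideanSpace ℝ (Fin m)) ≃L[ℝ] E :=
    (LinearEquiv.ofInjectiveOfFinrankEq Ψ0 hinj (by simp [hE, add_comm])).toContinuousLinearEquiv
  have hΨ : ∀ p, Ψ p = p.1 • u + ι p.2 := fun p => hΨ0 p
  have hd : ∀ p : ℝ × EuclideanSpace ℝ (Fin m),
      gaussDensity p.1 * gaussDensity p.2 = gaussDensity (Ψ p) := fun p => by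
    rw [hΨ, gaussDensity, gaussDensity, gaussDensity, hnorm,
      ← ENNReal.ofReal_mul (Real.exp_pos _).le, ← Real.exp_add]
    congr 2; ring
  have h1 : ∫⁻ p, gaussDensity (Ψ p) ∂((volume : Measure ℝ).prod
      (volume : Measure (EuclideanSpace ℝ (Fin m)))) = 1 := by
    simp_rw [← hd]
    rw [lintegral_prod_mul measurable_gaussDensity.aemeasurable measurable_gaussDensity.aemeasurable]
    simp [lintegral_gaussDensity]
  have := measurePreserving_withDensity_of_linear ((volume : Measure ℝ).prod
      (volume : Measure (EuclideanSpace ℝ (Fin m)))) (volume : Measure E) Ψ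
      measurable_gaussDensity h1 lintegral_gaussDensity
  rw [gauss_prod_eq]
  simp_rw [hd]
  rw [show (fun p : ℝ × EuclideanSpace ℝ (Fin m) => p.1 • u + ι p.2) = Ψ from
    funext fun p => (hΨ p).symm]
  exact this

/-- Rotating a pair of independent Gaussian vectors preserves their joint law. -/
lemma measurePreserving_rotation {c s : ℝ} (h : c ^ 2 + s ^ 2 = 1) :
    MeasurePreserving (fun p : E × E => (c • p.1 - s • p.2, s • p.1 + c • p.2))
      ((gauss E).prod (gauss E)) ((gauss E).prod (gauss E)) := by
  let R : ℝ → (E × E →ₗ[ℝ] E × E) := fun s =>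
    (c • LinearMap.fst ℝ E E - s • LinearMap.snd ℝ E E).prod
      (s • LinearMap.fst ℝ E E + c • LinearMap.snd ℝ E E)
  have hR : ∀ s p, R s p = (c • p.1 - s • p.2, s • p.1 + c • p.2) := fun s p => rfl
  have key : ∀ s : ℝ, c ^ 2 + s ^ 2 = 1 → ∀ p, R s (R (-s) p) = p := fun s h p => by
    rw [hR, hR]
    ext1
    · change c • (c • p.1 - (-s) • p.2) - s • ((-s) • p.1 + c • p.2) = p.1
      calc _ = (c ^ 2 + s ^ 2) • p.1 := by module
        _ = p.1 := by rw [h, one_smul]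
    · change s • (c • p.1 - (-s) • p.2) + c • ((-s) • p.1 + c • p.2) = p.2
      calc _ = (c ^ 2 + s ^ 2) • p.2 := by module
        _ = p.2 := by rw [h, one_smul]
  let Ψ : (E × E) ≃L[ℝ] (E × E) := (LinearEquiv.ofLinearMap (R s) (R (-s))
    (LinearMap.ext fun p => key s h p)
    (LinearMap.ext fun p => by simpa using key (-s) (by simpa using h) p)).toContinuousLinearEquiv
  have hΨ : ∀ p, Ψ p = (c • p.1 - s • p.2, s • p.1 + c • p.2) := fun p => rfl
  have hd : ∀ p : E × E, gaussDensity (Ψ p).1 * gaussDensity (Ψ p).2 =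
      gaussDensity p.1 * gaussDensity p.2 := fun p => by
    rw [hΨ]
    simp only [gaussDensity]
    rw [← ENNReal.ofReal_mul (Real.exp_pos _).le, ← Real.exp_add,
      ← ENNReal.ofReal_mul (Real.exp_pos _).le, ← Real.exp_add]
    congr 2
    rw [norm_sub_sq_real, norm_add_sq_real]
    simp only [norm_smul, inner_smul_left, inner_smul_right, mul_pow, Real.norm_eq_abs, sq_abs]
    simp only [RCLike.conj_to_real]
    linear_combination (-π * (‖p.1‖ ^ 2 + ‖p.2‖ ^ 2)) * h
  have h1 : ∫⁻ p, gaussDensity p.1 * gaussDensity p.2 ∂((volume : Measure E).prod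
      (volume : Measure E)) = 1 := by
    rw [lintegral_prod_mul measurable_gaussDensity.aemeasurable measurable_gaussDensity.aemeasurable]
    simp [lintegral_gaussDensity]
  have hm : Measurable fun p : E × E => gaussDensity p.1 * gaussDensity p.2 :=
    (measurable_gaussDensity.comp measurable_fst).mul (measurable_gaussDensity.comp measurable_snd)
  have := measurePreserving_withDensity_of_linear ((volume : Measure E).prod
      (volume : Measure E)) ((volume : Measure E).prod
      (volume : Measure E)) Ψ hm (by simp_rw [hd]; exact h1) h1
  rw [gauss_prod_eq]
  simp_rw [hd] at this
  exact this

end Gaussian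

section LogKernels

/-- The second moment of the Gaussian measure with density `exp (-π ‖x‖²)`. -/
lemma lintegral_gauss_sq_norm {E : Type*} [NormedAddCommGroup E] [InnerProductSpace ℝ E]
    [FiniteDimensional ℝ E] [MeasurableSpace E] [BorelSpace E] [Nontrivial E] :
    ∫⁻ x, ENNReal.ofReal (‖x‖ ^ 2) ∂gauss E =
      ENNReal.ofReal (Module.finrank ℝ E / (2 * π)) := by
  set N := Module.finrank ℝ E with hN
  have hNpos : 0 < N := Module.finrank_pos
  have hN' : (0 : ℝ) < N := by exact_mod_cast hNpos
  have h1 : ∫ x : E, rexp (-π * ‖x‖ ^ 2) = 1 := by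
    rw [GaussianFourier.integral_rexp_neg_mul_sq_norm Real.pi_pos, div_self Real.pi_ne_zero]
    simp
  have hI : ∀ q : ℝ, -1 < q → ∫ y in Ioi (0 : ℝ), y ^ q * rexp (-π * y ^ (2 : ℝ)) =
      π ^ (-(q + 1) / 2) * (1 / 2) * Gamma ((q + 1) / 2) := fun q hq =>
    integral_rpow_mul_exp_neg_mul_rpow (by norm_num) hq Real.pi_pos
  have hA := integral_fun_norm_addHaar (volume : Measure E) (fun y => rexp (-π * y ^ 2))
  have hB := integral_fun_norm_addHaar (volume : Measure E)
    (fun y => y ^ 2 * rexp (-π * y ^ 2))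
  rw [h1] at hA
  have eA : ∫ y in Ioi (0 : ℝ), y ^ (N - 1) • rexp (-π * y ^ 2) =
      ∫ y in Ioi (0 : ℝ), y ^ ((N : ℝ) - 1) * rexp (-π * y ^ (2 : ℝ)) := by
    refine setIntegral_congr_fun measurableSet_Ioi fun y hy => ?_
    simp only [smul_eq_mul, Real.rpow_two]
    rw [← Real.rpow_natCast, Nat.cast_sub hNpos, Nat.cast_one]
  have eB : ∫ y in Ioi (0 : ℝ), y ^ (N - 1) • (y ^ 2 * rexp (-π * y ^ 2)) =
      ∫ y in Ioi (0 : ℝ), y ^ ((N : ℝ) + 1) * rexp (-π * y ^ (2 : ℝ)) := by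
    refine setIntegral_congr_fun measurableSet_Ioi fun y hy => ?_
    simp only [smul_eq_mul, Real.rpow_two]
    rw [← mul_assoc, ← pow_add, ← Real.rpow_natCast]
    congr 2
    have : N - 1 + 2 = N + 1 := by omega
    rw [this]; push_cast; ring
  rw [← hN, eA, hI _ (by linarith)] at hA
  rw [← hN, eB, hI _ (by linarith)] at hB
  have hG : Gamma (((N : ℝ) + 1 + 1) / 2) = N / 2 * Gamma (N / 2) := by
    rw [show ((N : ℝ) + 1 + 1) / 2 = N / 2 + 1 by ring, Real.Gamma_add_one (by positivity)]
  have hP : π ^ (-((N : ℝ) + 1 + 1) / 2) = π⁻¹ * π ^ (-(N : ℝ) / 2) := by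
    rw [show (-((N : ℝ) + 1 + 1) / 2) = -1 + -(N : ℝ) / 2 by ring, Real.rpow_add Real.pi_pos,
      Real.rpow_neg_one]
  rw [sub_add_cancel] at hA
  have hval : ∫ x : E, ‖x‖ ^ 2 * rexp (-π * ‖x‖ ^ 2) = N / (2 * π) := by
    rw [hB, hG, hP]
    calc _ = (N / (2 * π)) * (N • (volume : Measure E).real (Metric.ball 0 1) •
          (π ^ (-(N : ℝ) / 2) * (1 / 2) * Gamma (N / 2))) := by
            simp only [nsmul_eq_mul, smul_eq_mul]
            field_simp
      _ = _ := by rw [← hA, mul_one]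
  rw [lintegral_gauss, ← hval, ofReal_integral_eq_lintegral_ofReal]
  · refine lintegral_congr fun x => ?_
    rw [gaussDensity, ← ENNReal.ofReal_mul (Real.exp_pos _).le, mul_comm]
  · refine Integrable.of_integral_ne_zero ?_
    rw [hval]; positivity
  · exact Filter.Eventually.of_forall fun x => by positivity

lemma lintegral_log_div_abs {R : ℝ} (hR : 0 < R) :
    ∫⁻ t : ℝ, ENNReal.ofReal (log (R / |t|)) = ENNReal.ofReal (2 * R) := by
  have hle : (-R) ≤ R := by linarith
  have hint : IntervalIntegrable (fun t => log R - log t) volume (-R) R :=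
    intervalIntegrable_const.sub intervalIntegral.intervalIntegrable_log'
  have hval : ∫ t in (-R)..R, (log R - log t) = 2 * R := by
    rw [intervalIntegral.integral_sub intervalIntegrable_const
      intervalIntegral.intervalIntegrable_log', integral_log, intervalIntegral.integral_const,
      Real.log_neg_eq_log, smul_eq_mul]
    ring
  have hout : ∀ t : ℝ, t ∉ Ioc (-R) R → ENNReal.ofReal (log (R / |t|)) = 0 := fun t ht => by
    rw [ENNReal.ofReal_eq_zero]
    have : R ≤ |t| := by
      by_contra! h
      rw [abs_lt] at h
      exact ht ⟨h.1, h.2.le⟩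
    exact Real.log_nonpos (by positivity) (div_le_one_of_le₀ this (abs_nonneg _))
  rw [← setLIntegral_eq_of_support_subset (s := Ioc (-R) R)]
  swap
  · intro t ht
    by_contra h
    exact ht (hout t h)
  have hae : ∀ᵐ t ∂(volume.restrict (Ioc (-R) R)),
      ENNReal.ofReal (log (R / |t|)) = ENNReal.ofReal (log R - log t) := by
    filter_upwards [ae_restrict_of_ae (Measure.ae_ne volume (0 : ℝ))] with t ht
    rw [Real.log_div hR.ne' (abs_ne_zero.2 ht), Real.log_abs]
  rw [lintegral_congr_ae hae, ← hval, intervalIntegral.integral_of_le hle,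
    ofReal_integral_eq_lintegral_ofReal hint.1]
  filter_upwards [ae_restrict_of_ae (Measure.ae_ne volume (0 : ℝ)),
    ae_restrict_mem measurableSet_Ioc] with t ht hm
  change 0 ≤ log R - log t
  rw [← Real.log_abs t]
  have := Real.log_le_log (abs_pos.2 ht) (abs_le.2 ⟨hm.1.le, hm.2⟩)
  linarith

lemma lintegral_gauss_log_div_norm_sub_le {δ : ℝ} (hδ : 0 < δ) (b : ℂ) :
    ∫⁻ c : ℝ, ENNReal.ofReal (log (δ / ‖(c : ℂ) - b‖)) ∂gauss ℝ ≤ ENNReal.ofReal (2 * δ) := by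
  calc _ = ∫⁻ c : ℝ, gaussDensity c * ENNReal.ofReal (log (δ / ‖(c : ℂ) - b‖)) := lintegral_gauss
    _ ≤ ∫⁻ c : ℝ, ENNReal.ofReal (log (δ / |c - b.re|)) := by
      refine lintegral_mono_ae ?_
      filter_upwards [Measure.ae_ne volume b.re] with c hc
      have h1 : gaussDensity c ≤ 1 := by
        rw [gaussDensity, ENNReal.ofReal_le_one, Real.exp_le_one_iff]
        have := Real.pi_pos
        nlinarith [sq_nonneg ‖c‖]
      have hpos : 0 < |c - b.re| := abs_pos.2 (sub_ne_zero.2 hc)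
      have h2 : |c - b.re| ≤ ‖(c : ℂ) - b‖ := by
        simpa using Complex.abs_re_le_norm ((c : ℂ) - b)
      calc _ ≤ 1 * ENNReal.ofReal (log (δ / ‖(c : ℂ) - b‖)) := by gcongr
        _ ≤ _ := by
          rw [one_mul]
          gcongr
          exact div_pos hδ (hpos.trans_le h2)
    _ = ENNReal.ofReal (2 * δ) := by
      rw [lintegral_sub_right_eq_self (fun c : ℝ => ENNReal.ofReal (log (δ / |c|))) b.re,
        lintegral_log_div_abs hδ]

lemma lintegral_log_div_abs_tan_le {R : ℝ} (hR : 0 < R) (θ : ℝ) :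
    ∫⁻ α in Ioo (-(π / 2)) (π / 2), ENNReal.ofReal (log (R / |tan (α + θ)|)) ≤
      ENNReal.ofReal (2 * R) := by
  set K : ℝ → ℝ≥0∞ := fun β => ENNReal.ofReal (log (R / |tan β|)) with hK
  have hper : ∀ (g : AddSubgroup.zmultiples π) (x : ℝ), K (g +ᵥ x) = K x := by
    rintro ⟨g, hg⟩ x
    obtain ⟨k, rfl⟩ := AddSubgroup.mem_zmultiples_iff.1 hg
    change K (k • π + x) = K x
    simp only [hK]
    rw [add_comm, zsmul_eq_mul, Real.tan_add_int_mul_pi]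
  have hd : ∀ t : ℝ, IsAddFundamentalDomain (AddSubgroup.zmultiples π) (Ioc t (t + π)) :=
    fun t => isAddFundamentalDomain_Ioc Real.pi_pos t
  calc _ ≤ ∫⁻ α in Ioc (-(π / 2)) (π / 2), K (α + θ) :=
        lintegral_mono_set Ioo_subset_Ioc_self
    _ = ∫⁻ β in Ioc (-(π / 2) + θ) (-(π / 2) + θ + π), K β := by
      have h := (measurePreserving_add_right (volume : Measure ℝ) θ).setLIntegral_comp_preimage_emb
        (measurableEmbedding_addRight θ) K (Ioc (-(π / 2) + θ) (-(π / 2) + θ + π))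
      rw [← h]
      congr 2
      ext x
      simp only [mem_Ioc, mem_preimage]
      constructor <;> rintro ⟨h1, h2⟩ <;> constructor <;> linarith
    _ = ∫⁻ β in Ioc (-(π / 2)) (-(π / 2) + π), K β := (hd _).setLIntegral_eq (hd _) K hper
    _ = ∫⁻ β in Ioo (-(π / 2)) (π / 2), K β := by
      rw [show -(π / 2) + π = π / 2 by ring, restrict_Ioo_eq_restrict_Ioc]
    _ ≤ ∫⁻ β in Ioo (-(π / 2)) (π / 2), ENNReal.ofReal (log (R / |β|)) := by
      refine setLIntegral_mono' measurableSet_Ioo fun β hβ => ?_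
      rcases eq_or_ne β 0 with rfl | h0
      · simp [hK]
      have : |β| ≤ |tan β| := by
        rcases le_total 0 β with h | h
        · rw [abs_of_nonneg h]
          exact (Real.le_tan h hβ.2).trans (le_abs_self _)
        · rw [abs_of_nonpos h]
          refine (Real.le_tan (neg_nonneg.2 h) (by linarith [hβ.1])).trans ?_
          rw [Real.tan_neg]; exact neg_le_abs _
      have hp : 0 < |β| := abs_pos.2 h0
      simp only [hK]
      gcongr
      exact div_pos hR (hp.trans_le this)
    _ ≤ ∫⁻ β, ENNReal.ofReal (log (R / |β|)) := setLIntegral_le_lintegral _ _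
    _ = _ := lintegral_log_div_abs hR

/-- The logarithmic kernel of a point of the complex projective line, integrated over the real
projective line. -/
lemma lintegral_log_projective_le {R : ℝ} (hR : 0 < R) (hR1 : R ≤ 1) {T₁ T₂ : ℂ} :
    ∫⁻ α in Ioo (-(π / 2)) (π / 2),
      ENNReal.ofReal (log (R * (‖T₁ * cos α - T₂ * sin α‖ / ‖T₁ * sin α + T₂ * cos α‖))) ≤
      ENNReal.ofReal (2 * R) := by
  set ζ : ℂ := ⟨‖T₁‖ ^ 2 - ‖T₂‖ ^ 2, 2 * (T₁.re * T₂.re + T₁.im * T₂.im)⟩ with hζ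
  refine le_trans (lintegral_mono_ae ?_) (lintegral_log_div_abs_tan_le hR (ζ.arg / 2))
  have hcount : (range fun k : ℤ => (k : ℝ) * π - ζ.arg / 2).Countable := countable_range _
  filter_upwards [ae_restrict_of_ae (hcount.ae_notMem volume)] with α hα
  set β := α + ζ.arg / 2 with hβ
  set p := ‖T₁ * cos α - T₂ * sin α‖ with hp
  set q := ‖T₁ * sin α + T₂ * cos α‖ with hq
  set c := cos (2 * β) with hc
  set N := ‖T₁‖ ^ 2 + ‖T₂‖ ^ 2 with hN
  have hsin : sin β ≠ 0 := by
    intro h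
    obtain ⟨k, hk⟩ := Real.sin_eq_zero_iff.1 h
    exact hα ⟨k, by simp only [hk, hβ]; ring⟩
  have hsum : p ^ 2 + q ^ 2 = N := by
    rw [hp, hq, hN]
    simp only [← Complex.normSq_eq_norm_sq, Complex.normSq_apply]
    simp [-Complex.ofReal_cos, -Complex.ofReal_sin]
    linear_combination (T₁.re ^ 2 + T₁.im ^ 2 + T₂.re ^ 2 + T₂.im ^ 2) *
      Real.sin_sq_add_cos_sq α
  have hdiff : p ^ 2 - q ^ 2 = ‖ζ‖ * c := by
    have h1 : c = cos (2 * α) * cos ζ.arg - sin (2 * α) * sin ζ.arg := by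
      rw [hc, hβ, ← Real.cos_add]; congr 1; ring
    have hre := Complex.norm_mul_cos_arg ζ
    have him := Complex.norm_mul_sin_arg ζ
    have : ‖ζ‖ * c = cos (2 * α) * ζ.re - sin (2 * α) * ζ.im := by
      rw [h1, ← hre, ← him]; ring
    rw [this, Real.cos_two_mul', Real.sin_two_mul, hp, hq]
    simp only [hζ, ← Complex.normSq_eq_norm_sq, Complex.normSq_apply]
    simp [-Complex.ofReal_cos, -Complex.ofReal_sin]
    ring
  have hAN : ‖ζ‖ ≤ N := by
    refine le_of_sq_le_sq ?_ (by positivity)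
    rw [← Complex.normSq_eq_norm_sq, Complex.normSq_apply, hN]
    simp only [hζ, ← Complex.normSq_eq_norm_sq, Complex.normSq_apply]
    nlinarith [sq_nonneg (T₁.re * T₂.im - T₁.im * T₂.re)]
  by_cases hle : log (R * (p / q)) ≤ 0
  · rw [ENNReal.ofReal_eq_zero.2 hle]; exact zero_le
  push Not at hle
  have hp0 : 0 ≤ p := norm_nonneg _
  have hq0 : 0 ≤ q := norm_nonneg _
  have hnn : 0 ≤ R * (p / q) := by positivity
  have h1 : 1 < R * (p / q) := by
    by_contra! h
    exact absurd (Real.log_nonpos hnn h) (not_le.2 hle)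
  have hqpos : 0 < q := by
    rcases hq0.eq_or_lt with h | h
    · rw [← h] at h1; simp at h1; linarith
    · exact h
  have hpq : q < p := by
    have h2 : R * (p / q) ≤ p / q := mul_le_of_le_one_left (by positivity) hR1
    have := h1.trans_le h2
    rwa [one_lt_div hqpos] at this
  have hc0 : 0 ≤ c := by
    have : 0 < ‖ζ‖ * c := by rw [← hdiff]; nlinarith
    by_contra! h
    exact absurd this (not_lt.2 (mul_nonpos_of_nonneg_of_nonpos (norm_nonneg _) h.le))
  have hcb : c = 2 * cos β ^ 2 - 1 := Real.cos_two_mul β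
  have hsc := Real.sin_sq_add_cos_sq β
  have hmain : (p * |sin β|) ≤ q * |cos β| := by
    refine le_of_sq_le_sq ?_ (by positivity)
    rw [mul_pow, mul_pow, sq_abs, sq_abs]
    have e1 : sin β ^ 2 = (1 - c) / 2 := by rw [hcb]; linarith
    have e2 : cos β ^ 2 = (1 + c) / 2 := by rw [hcb]; ring
    have e3 : p ^ 2 = (N + ‖ζ‖ * c) / 2 := by linarith
    have e4 : q ^ 2 = (N - ‖ζ‖ * c) / 2 := by linarith
    rw [e1, e2, e3, e4]
    nlinarith [mul_nonneg (sub_nonneg.2 hAN) hc0]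
  have hcos : 0 < |cos β| := by
    have : 0 < p * |sin β| := mul_pos (hqpos.trans hpq) (abs_pos.2 hsin)
    by_contra! h
    nlinarith
  gcongr
  rw [Real.tan_eq_sin_div_cos, abs_div, div_eq_mul_inv R, inv_div]
  refine mul_le_mul_of_nonneg_left ?_ hR.le
  rwa [div_le_div_iff₀ hqpos (abs_pos.2 hsin), mul_comm |cos β|]

end LogKernels

section LineSeries

variable {ι : Type*}

/-- The Taylor expansion of `s ↦ P (x + s y)` at `s = 0`, as a formal power series. -/
noncomputable def lineSeries (P : MvPolynomial ι ℝ) (x y : ι → ℝ) : PowerSeries ℝ :=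
  MvPolynomial.aeval (fun i => PowerSeries.C (x i) + PowerSeries.X * PowerSeries.C (y i)) P

/-- The polynomial `s ↦ P (x + s y)`. -/
noncomputable def linePoly (P : MvPolynomial ι ℝ) (x y : ι → ℝ) : Polynomial ℝ :=
  MvPolynomial.aeval (fun i => Polynomial.C (x i) + Polynomial.X * Polynomial.C (y i)) P

/-- The Taylor coefficients at `s = 0` of `s ↦ P x / P (x + s y)`. -/
noncomputable def invCoeff (P : MvPolynomial ι ℝ) (x y : ι → ℝ) (j : ℕ) : ℝ :=
  MvPolynomial.eval x P * PowerSeries.coeff j (lineSeries P x y)⁻¹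

lemma coe_linePoly (P : MvPolynomial ι ℝ) (x y : ι → ℝ) :
    (linePoly P x y : PowerSeries ℝ) = lineSeries P x y := by
  have h : (Polynomial.coeToPowerSeries.algHom ℝ).comp (MvPolynomial.aeval
      (fun i => Polynomial.C (x i) + Polynomial.X * Polynomial.C (y i))) =
      MvPolynomial.aeval (R := ℝ)
        (fun i => PowerSeries.C (x i) + PowerSeries.X * PowerSeries.C (y i)) := by
    ext i : 1
    simp [Polynomial.coeToPowerSeries.algHom_apply]
    ring
  have h2 := DFunLike.congr_fun h P
  simpa [Polynomial.coeToPowerSeries.algHom_apply, linePoly, lineSeries] using h2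

lemma aeval_linePoly {A : Type*} [CommRing A] [Algebra ℝ A] (P : MvPolynomial ι ℝ)
    (x y : ι → ℝ) (s : A) :
    Polynomial.aeval s (linePoly P x y) =
      MvPolynomial.aeval (fun i => algebraMap ℝ A (x i) + s * algebraMap ℝ A (y i)) P := by
  have h : (Polynomial.aeval s).comp (MvPolynomial.aeval
      (fun i => Polynomial.C (x i) + Polynomial.X * Polynomial.C (y i))) =
      MvPolynomial.aeval (R := ℝ)
        (fun i => algebraMap ℝ A (x i) + s * algebraMap ℝ A (y i)) := by
    ext i : 1
    simp
    ring
  exact DFunLike.congr_fun h P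

lemma eval_linePoly (P : MvPolynomial ι ℝ) (x y : ι → ℝ) (s : ℝ) :
    (linePoly P x y).eval s = MvPolynomial.eval (fun i => x i + s * y i) P := by
  have := aeval_linePoly P x y s
  simpa [Polynomial.coe_aeval_eq_eval, MvPolynomial.aeval_eq_eval] using this

lemma constantCoeff_lineSeries (P : MvPolynomial ι ℝ) (x y : ι → ℝ) :
    PowerSeries.constantCoeff (lineSeries P x y) = MvPolynomial.eval x P := by
  rw [← coe_linePoly, Polynomial.constantCoeff_coe, Polynomial.coeff_zero_eq_eval_zero]
  simp [eval_linePoly]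

lemma coeff_C_add_X_mul_C {R : Type*} [CommRing R] (a b : R) (j : ℕ) :
    PowerSeries.coeff j (PowerSeries.C a + PowerSeries.X * PowerSeries.C b) =
      if j = 0 then a else if j = 1 then b else 0 := by
  rcases j with _ | j
  · simp
  · rw [map_add, PowerSeries.coeff_succ_X_mul, PowerSeries.coeff_C, PowerSeries.coeff_C]
    simp

section Measurability

variable {Ω : Type*} [MeasurableSpace Ω]

lemma measurable_coeff_mul {A B : Ω → PowerSeries ℝ}
    (hA : ∀ j, Measurable fun q => PowerSeries.coeff j (A q))
    (hB : ∀ j, Measurable fun q => PowerSeries.coeff j (B q)) (j : ℕ) :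
    Measurable fun q => PowerSeries.coeff j (A q * B q) := by
  simp_rw [PowerSeries.coeff_mul]
  exact Finset.measurable_sum _ fun p _ => (hA p.1).mul (hB p.2)

lemma measurable_coeff_inv {A : Ω → PowerSeries ℝ}
    (hA : ∀ j, Measurable fun q => PowerSeries.coeff j (A q)) (j : ℕ) :
    Measurable fun q => PowerSeries.coeff j (A q)⁻¹ := by
  induction j using Nat.strong_induction_on with
  | _ j ih =>
    have h0 : Measurable fun q => PowerSeries.constantCoeff (A q) := by
      simpa using hA 0
    rw [funext fun q => PowerSeries.coeff_inv j (A q)]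
    split_ifs with hj
    · exact h0.inv
    · refine h0.inv.neg.mul (Finset.measurable_sum _ fun p _ => ?_)
      split_ifs with hp
      · exact (hA _).mul (ih _ hp)
      · exact measurable_const

lemma measurable_coeff_lineSeries (P : MvPolynomial ι ℝ) {x y : Ω → ι → ℝ}
    (hx : ∀ i, Measurable fun q => x q i) (hy : ∀ i, Measurable fun q => y q i) (j : ℕ) :
    Measurable fun q => PowerSeries.coeff j (lineSeries P (x q) (y q)) := by
  induction P using MvPolynomial.induction_on generalizing j with
  | C a => simp [lineSeries, PowerSeries.coeff_C]
  | add p q hp hq =>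
    simp only [lineSeries, map_add] at hp hq ⊢
    exact (hp j).add (hq j)
  | mul_X p i hp =>
    simp only [lineSeries, map_mul, MvPolynomial.aeval_X] at hp ⊢
    refine measurable_coeff_mul hp (fun j => ?_) j
    simp_rw [coeff_C_add_X_mul_C]
    split_ifs
    exacts [hx i, hy i, measurable_const]

lemma measurable_eval (P : MvPolynomial ι ℝ) {x : Ω → ι → ℝ}
    (hx : ∀ i, Measurable fun q => x q i) :
    Measurable fun q => MvPolynomial.eval (x q) P := by
  have := measurable_coeff_lineSeries P hx hx 0
  simpa [constantCoeff_lineSeries] using this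

lemma measurable_invCoeff (P : MvPolynomial ι ℝ) {x y : Ω → ι → ℝ}
    (hx : ∀ i, Measurable fun q => x q i) (hy : ∀ i, Measurable fun q => y q i) (j : ℕ) :
    Measurable fun q => invCoeff P (x q) (y q) j :=
  (measurable_eval P hx).mul
    (measurable_coeff_inv (measurable_coeff_lineSeries P hx hy) j)

end Measurability

/-- `A` is a power series in `s` over `ℝ[c]` whose `j`-th coefficient has degree at most `j`
in `c`, with `c ^ j`-coefficient equal to the `j`-th coefficient of `B`. -/
def HasTopPart (A : PowerSeries (Polynomial ℝ)) (B : PowerSeries ℝ) : Prop :=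
  ∀ j, (PowerSeries.coeff j A).natDegree ≤ j ∧
    (PowerSeries.coeff j A).coeff j = PowerSeries.coeff j B

lemma HasTopPart.mul {A A' : PowerSeries (Polynomial ℝ)} {B B' : PowerSeries ℝ}
    (h : HasTopPart A B) (h' : HasTopPart A' B') : HasTopPart (A * A') (B * B') := by
  intro j
  simp_rw [PowerSeries.coeff_mul]
  constructor
  · refine Polynomial.natDegree_sum_le_of_forall_le _ _ fun p hp => ?_
    rw [← Finset.HasAntidiagonal.mem_antidiagonal.1 hp]
    exact Polynomial.natDegree_mul_le_of_le (h _).1 (h' _).1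
  · rw [Polynomial.finsetSum_coeff]
    refine Finset.sum_congr rfl fun p hp => ?_
    rw [← (h _).2, ← (h' _).2]
    conv_lhs => rw [← Finset.HasAntidiagonal.mem_antidiagonal.1 hp]
    exact Polynomial.coeff_mul_add_eq_of_natDegree_le (h _).1 (h' _).1

lemma HasTopPart.invOfUnit {A : PowerSeries (Polynomial ℝ)} {B : PowerSeries ℝ}
    (h : HasTopPart A B) (a : ℝˣ) (ha : PowerSeries.constantCoeff B = a) :
    HasTopPart (A.invOfUnit (Units.map (Polynomial.C : ℝ →+* Polynomial ℝ) a)) B⁻¹ := by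
  have hC : ((Units.map (Polynomial.C : ℝ →+* Polynomial ℝ).toMonoidHom a)⁻¹ :
      (Polynomial ℝ)ˣ).val = Polynomial.C (a : ℝ)⁻¹ := by
    rw [← map_inv]; simp
  intro j
  induction j using Nat.strong_induction_on with
  | _ j ih =>
    rw [PowerSeries.coeff_invOfUnit, PowerSeries.coeff_inv, ha]
    split_ifs with hj
    · subst hj
      simp
    · have hC' : -((Units.map (Polynomial.C : ℝ →+* Polynomial ℝ).toMonoidHom a)⁻¹ :
          (Polynomial ℝ)ˣ).val = Polynomial.C (-(a : ℝ)⁻¹) := by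
        rw [hC]; simp
      have key : ∀ p ∈ Finset.HasAntidiagonal.antidiagonal j,
          (if p.2 < j then PowerSeries.coeff p.1 A * PowerSeries.coeff p.2
            (A.invOfUnit (Units.map (Polynomial.C : ℝ →+* Polynomial ℝ) a))
            else 0).natDegree ≤ j ∧
          (if p.2 < j then PowerSeries.coeff p.1 A * PowerSeries.coeff p.2
            (A.invOfUnit (Units.map (Polynomial.C : ℝ →+* Polynomial ℝ) a))
            else 0).coeff j =
          if p.2 < j then PowerSeries.coeff p.1 B * PowerSeries.coeff p.2 B⁻¹ else 0 := by
        intro p hp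
        split_ifs with hpj
        · obtain ⟨h1, h2⟩ := h p.1
          obtain ⟨h3, h4⟩ := ih p.2 hpj
          rw [← h2, ← h4]
          have hj' := Finset.HasAntidiagonal.mem_antidiagonal.1 hp
          constructor
          · rw [← hj']
            exact Polynomial.natDegree_mul_le_of_le h1 h3
          · rw [← Polynomial.coeff_mul_add_eq_of_natDegree_le h1 h3, hj']
        · simp
      constructor
      · erw [hC']
        refine (Polynomial.natDegree_C_mul_le _ _).trans ?_
        exact Polynomial.natDegree_sum_le_of_forall_le _ _ fun p hp => (key p hp).1
      · erw [hC']
        rw [Polynomial.coeff_C_mul, Polynomial.finsetSum_coeff]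
        congr 1
        exact Finset.sum_congr rfl fun p hp => (key p hp).2

lemma hasTopPart_aeval (P : MvPolynomial ι ℝ) (x u v : ι → ℝ) :
    HasTopPart (MvPolynomial.aeval (fun i => PowerSeries.C (Polynomial.C (x i)) +
      PowerSeries.X * PowerSeries.C
        (Polynomial.C (v i) + Polynomial.X * Polynomial.C (u i))) P)
      (lineSeries P x u) := by
  induction P using MvPolynomial.induction_on with
  | C a =>
    intro j
    simp only [lineSeries, MvPolynomial.algHom_C, PowerSeries.algebraMap_apply,
      PowerSeries.coeff_C]
    split_ifs with hj
    · subst hj; simp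
    · simp
  | add p q hp hq =>
    intro j
    simp only [lineSeries, map_add] at hp hq ⊢
    exact ⟨Polynomial.natDegree_add_le_of_degree_le (hp j).1 (hq j).1, by
      rw [Polynomial.coeff_add, (hp j).2, (hq j).2]⟩
  | mul_X p i hp =>
    simp only [lineSeries, map_mul, MvPolynomial.aeval_X] at hp ⊢
    refine hp.mul fun j => ?_
    rw [coeff_C_add_X_mul_C, coeff_C_add_X_mul_C]
    split_ifs with h0 h1
    · subst h0; simp
    · subst h1
      refine ⟨by compute_degree, by simp [Polynomial.coeff_C]⟩
    · simp

/-- Along a line `c ↦ c u + v`, the coefficient `invCoeff P x · j` is a polynomial of degree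
at most `j` with leading coefficient `invCoeff P x u j`. -/
lemma exists_poly_invCoeff {P : MvPolynomial ι ℝ} {x : ι → ℝ}
    (hx : MvPolynomial.eval x P ≠ 0) (u v : ι → ℝ) (j : ℕ) :
    ∃ T : Polynomial ℝ, T.natDegree ≤ j ∧ T.coeff j = invCoeff P x u j ∧
      ∀ c : ℝ, T.eval c = invCoeff P x (fun i => c * u i + v i) j := by
  set A : PowerSeries (Polynomial ℝ) := MvPolynomial.aeval (fun i =>
    PowerSeries.C (Polynomial.C (x i)) + PowerSeries.X * PowerSeries.C
        (Polynomial.C (v i) + Polynomial.X * Polynomial.C (u i))) P with hA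
  have hT : HasTopPart A (lineSeries P x u) := hasTopPart_aeval P x u v
  set a : ℝˣ := Units.mk0 _ hx with ha
  set U : (Polynomial ℝ)ˣ := Units.map (Polynomial.C : ℝ →+* Polynomial ℝ) a with hU
  have hI := hT.invOfUnit a (by simp [constantCoeff_lineSeries, ha])
  have hmap : ∀ c : ℝ, PowerSeries.map (Polynomial.evalRingHom c) A =
      lineSeries P x (fun i => c * u i + v i) := by
    intro c
    have h : (PowerSeries.map (Polynomial.evalRingHom c)).comp
        (MvPolynomial.aeval (R := ℝ) (fun i =>
          PowerSeries.C (Polynomial.C (x i)) + PowerSeries.X * PowerSeries.C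
        (Polynomial.C (v i) + Polynomial.X * Polynomial.C (u i)))).toRingHom =
        (MvPolynomial.aeval (R := ℝ) (fun i => PowerSeries.C (x i) +
          PowerSeries.X * PowerSeries.C (c * u i + v i))).toRingHom := by
      apply MvPolynomial.ringHom_ext
      · intro r
        simp [PowerSeries.algebraMap_apply]
      · intro i
        simp
        ring
    exact DFunLike.congr_fun h P
  have hconst : PowerSeries.constantCoeff A = U := by
    have h : (PowerSeries.constantCoeff (R := Polynomial ℝ)).comp
        (MvPolynomial.aeval (R := ℝ) (fun i =>
          PowerSeries.C (Polynomial.C (x i)) + PowerSeries.X * PowerSeries.C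
        (Polynomial.C (v i) + Polynomial.X * Polynomial.C (u i)))).toRingHom =
        (Polynomial.C : ℝ →+* Polynomial ℝ).comp (MvPolynomial.eval x) := by
      apply MvPolynomial.ringHom_ext
      · intro r
        simp [PowerSeries.algebraMap_apply]
      · intro i
        simp
    exact DFunLike.congr_fun h P
  refine ⟨Polynomial.C (MvPolynomial.eval x P) * PowerSeries.coeff j (A.invOfUnit U),
    (Polynomial.natDegree_C_mul_le _ _).trans (hI j).1, ?_, fun c => ?_⟩
  · rw [Polynomial.coeff_C_mul, (hI j).2, invCoeff]
  · rw [Polynomial.eval_mul, Polynomial.eval_C, invCoeff]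
    congr 1
    have h1 : A * A.invOfUnit U = 1 := PowerSeries.mul_invOfUnit A U hconst
    have h2 := congrArg (PowerSeries.map (Polynomial.evalRingHom c)) h1
    rw [map_mul, map_one, hmap] at h2
    have h3 : PowerSeries.map (Polynomial.evalRingHom c) (A.invOfUnit U) =
        (lineSeries P x (fun i => c * u i + v i))⁻¹ := by
      rw [PowerSeries.eq_inv_iff_mul_eq_one, mul_comm, h2]
      rwa [constantCoeff_lineSeries]
    rw [← h3]
    simp

/-- The radius of convergence of `P x / P (x + s u)` is at most the modulus of a zero. -/
lemma exists_pow_le_abs_invCoeff {P : MvPolynomial ι ℝ} {x u : ι → ℝ}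
    (hx : MvPolynomial.eval x P ≠ 0) {r ρ : ℝ} (hr : 0 < r) (hρ : r < ρ)
    (hz : MvPolynomial.eval (fun i => x i + r * u i) P = 0) (J : ℕ) :
    ∃ j ≥ J, (ρ⁻¹) ^ j ≤ |invCoeff P x u j| := by
  by_contra! hcon
  have hρ0 : 0 < ρ := hr.trans hρ
  set p := linePoly P x u with hp
  have hsb : Summable fun j => ‖invCoeff P x u j * r ^ j‖ := by
    have hg : Summable fun j : ℕ => (r / ρ) ^ j :=
      summable_geometric_of_lt_one (by positivity) ((div_lt_one hρ0).2 hρ)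
    refine hg.of_norm_bounded_eventually_nat ?_
    filter_upwards [Filter.eventually_ge_atTop J] with j hj
    rw [norm_norm, norm_mul, Real.norm_eq_abs, Real.norm_eq_abs, abs_of_pos (pow_pos hr j),
      div_eq_inv_mul, mul_pow]
    exact mul_le_mul_of_nonneg_right (hcon j hj).le (by positivity)
  have hzero : ∀ j ∉ Finset.range (p.natDegree + 1), p.coeff j * r ^ j = 0 := by
    intro j hj
    rw [Polynomial.coeff_eq_zero_of_natDegree_lt (by simpa using hj), zero_mul]
  have hsp : Summable fun j => ‖p.coeff j * r ^ j‖ :=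
    summable_of_ne_finset_zero (s := Finset.range (p.natDegree + 1)) fun j hj => by
      rw [hzero j hj, norm_zero]
  have hprod := tsum_mul_tsum_eq_tsum_sum_antidiagonal_of_summable_norm hsp hsb
  have h0 : ∑' j, p.coeff j * r ^ j = 0 := by
    rw [← hz, ← eval_linePoly, ← hp, Polynomial.eval_eq_sum_range, tsum_eq_sum hzero]
  have hconv : ∀ j, ∑ q ∈ Finset.HasAntidiagonal.antidiagonal j,
      (p.coeff q.1 * r ^ q.1) * (invCoeff P x u q.2 * r ^ q.2) =
      if j = 0 then MvPolynomial.eval x P else 0 := by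
    intro j
    have h1 : lineSeries P x u * (lineSeries P x u)⁻¹ = 1 :=
      PowerSeries.mul_inv_cancel _ (by rwa [constantCoeff_lineSeries])
    have h2 := congrArg (PowerSeries.coeff j) h1
    rw [PowerSeries.coeff_mul, PowerSeries.coeff_one] at h2
    have h3 : ∑ q ∈ Finset.HasAntidiagonal.antidiagonal j,
        (p.coeff q.1 * r ^ q.1) * (invCoeff P x u q.2 * r ^ q.2) =
        MvPolynomial.eval x P * r ^ j * ∑ q ∈ Finset.HasAntidiagonal.antidiagonal j,
          PowerSeries.coeff q.1 (lineSeries P x u) *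
            PowerSeries.coeff q.2 (lineSeries P x u)⁻¹ := by
      rw [Finset.mul_sum]
      refine Finset.sum_congr rfl fun q hq => ?_
      rw [← Finset.HasAntidiagonal.mem_antidiagonal.1 hq, pow_add, invCoeff, hp, ← coe_linePoly,
        Polynomial.coeff_coe]
      ring
    rw [h3, h2]
    split_ifs with hj
    · simp [hj]
    · simp
  simp_rw [hconv] at hprod
  rw [h0, zero_mul, tsum_ite_eq] at hprod
  exact hx hprod.symm

end LineSeries

section Roots

lemma aeval_mul_of_isHomogeneous {ι A : Type*} [CommRing A] [Algebra ℝ A]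
    {P : MvPolynomial ι ℝ} {k : ℕ} (hP : P.IsHomogeneous k) (ξ : A) (z : ι → A) :
    MvPolynomial.aeval (fun i => ξ * z i) P = ξ ^ k * MvPolynomial.aeval z P := by
  rw [MvPolynomial.aeval_def, MvPolynomial.aeval_def, MvPolynomial.eval₂_eq,
    MvPolynomial.eval₂_eq, Finset.mul_sum]
  refine Finset.sum_congr rfl fun d hd => ?_
  have h := hP (MvPolynomial.mem_support_iff.1 hd)
  have h2 : ∑ i ∈ d.support, d i = k := by
    rw [← h, Finsupp.weight_apply]
    simp [Finsupp.sum]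
  simp_rw [mul_pow]
  rw [Finset.prod_mul_distrib, Finset.prod_pow_eq_pow_sum, h2]
  ring

/-- A power series inverse of `∏ (1 + μ X)` with geometrically bounded coefficients. -/
lemma exists_inverse_prod_one_add (S : Multiset ℂ) {M : ℝ} (hM0 : 0 ≤ M)
    (hM : ∀ μ ∈ S, ‖μ‖ ≤ M) :
    ∃ g : PowerSeries ℂ,
      g * (S.map fun μ => 1 + PowerSeries.X * PowerSeries.C μ).prod = 1 ∧
      ∀ j : ℕ, ‖PowerSeries.coeff j g‖ ≤ ((j : ℝ) + 1) ^ S.card * M ^ j := by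
  induction S using Multiset.induction_on with
  | empty =>
    refine ⟨1, by simp, fun j => ?_⟩
    rw [PowerSeries.coeff_one]
    split_ifs with h
    · simp [h]
    · rw [norm_zero]; positivity
  | cons μ S ih =>
    obtain ⟨g, hg, hgj⟩ := ih fun ν hν => hM ν (Multiset.mem_cons_of_mem hν)
    have hμ := hM μ (Multiset.mem_cons_self μ S)
    refine ⟨g * PowerSeries.mk fun j => (-μ) ^ j, ?_, fun j => ?_⟩
    · have h1 : (PowerSeries.mk fun j => (-μ) ^ j) *
          (1 + PowerSeries.X * PowerSeries.C μ) = 1 := by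
        ext j
        rcases j with _ | j
        · simp
        · rw [mul_add, mul_one, ← mul_assoc, mul_comm _ PowerSeries.X, map_add, mul_assoc,
            PowerSeries.coeff_succ_X_mul, PowerSeries.coeff_mul_C]
          simp [pow_succ, PowerSeries.coeff_one]
      rw [Multiset.map_cons, Multiset.prod_cons, mul_comm (1 + _), mul_mul_mul_comm, h1, hg,
        one_mul]
    · rw [PowerSeries.coeff_mul]
      refine (norm_sum_le _ _).trans ?_
      have : ∀ p ∈ Finset.HasAntidiagonal.antidiagonal j,
          ‖PowerSeries.coeff p.1 g * PowerSeries.coeff p.2 (PowerSeries.mk fun j => (-μ) ^ j)‖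
            ≤ ((j : ℝ) + 1) ^ S.card * M ^ j := by
        intro p hp
        have hp' := Finset.HasAntidiagonal.mem_antidiagonal.1 hp
        rw [norm_mul, PowerSeries.coeff_mk, norm_pow, norm_neg]
        calc _ ≤ (((p.1 : ℝ) + 1) ^ S.card * M ^ p.1) * M ^ p.2 := by
              gcongr
              exact hgj _
          _ = ((p.1 : ℝ) + 1) ^ S.card * M ^ j := by rw [← hp', pow_add]; ring
          _ ≤ _ := by
              gcongr
              omega
      refine (Finset.sum_le_sum this).trans ?_
      rw [Finset.sum_const, Finset.Nat.card_antidiagonal, nsmul_eq_mul, Multiset.card_cons]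
      push_cast
      rw [pow_succ]
      exact le_of_eq (by ring)

/-- The linear factor attached to a projective root `T` after rotation by `α`. -/
noncomputable def rotFactor (α : ℝ) (T : ℂ × ℂ) : Polynomial ℂ :=
  Polynomial.C (-(T.1 * Real.sin α + T.2 * Real.cos α)) +
    Polynomial.X * Polynomial.C (T.1 * Real.cos α - T.2 * Real.sin α)

variable {ι : Type*}

lemma exists_factorization {P : MvPolynomial ι ℝ} {k : ℕ} (hP : P.IsHomogeneous k)
    (X Y : ι → ℝ) :
    ∃ (c : ℂ) (S : Multiset (ℂ × ℂ)), S.card = k ∧ ∀ α : ℝ,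
      (linePoly P (fun i => Real.cos α * X i - Real.sin α * Y i)
        (fun i => Real.sin α * X i + Real.cos α * Y i)).map (algebraMap ℝ ℂ) =
      Polynomial.C c * (S.map (rotFactor α)).prod := by
  set p := (linePoly P X Y).map (algebraMap ℝ ℂ) with hp
  have hdeg : p.natDegree ≤ k := by
    rw [hp, Polynomial.natDegree_map]
    refine (MvPolynomial.aeval_natDegree_le (m := k) (n := 1) P hP.totalDegree_le _
      fun i => ?_).trans_eq (mul_one k)
    compute_degree
  have hsplit := IsAlgClosed.splits p
  refine ⟨p.leadingCoeff, p.roots.map (fun T => ((1 : ℂ), T)) +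
    Multiset.replicate (k - p.natDegree) ((0 : ℂ), (-1 : ℂ)), ?_, fun α => ?_⟩
  · rw [Multiset.card_add, Multiset.card_map, Multiset.card_replicate,
      ← hsplit.natDegree_eq_card_roots]
    omega
  · apply Polynomial.eq_of_infinite_eval_eq
    set cα : ℂ := ((Real.cos α : ℝ) : ℂ) with hcα
    set sα : ℂ := ((Real.sin α : ℝ) : ℂ) with hsα
    have hcs : cα ^ 2 + sα ^ 2 = 1 := by
      rw [hcα, hsα]; exact_mod_cast Real.cos_sq_add_sin_sq α
    have hfin : {s : ℂ | cα + s * sα = 0}.Finite := by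
      by_cases hs : sα = 0
      · have hc : cα ≠ 0 := by
          intro hc; rw [hs, hc] at hcs; simp at hcs
        convert Set.finite_empty
        ext s; simp [hs, hc]
      · refine (Set.finite_singleton (-cα / sα)).subset fun s hs' => ?_
        simp only [mem_ofPred_eq] at hs'
        rw [mem_singleton_iff, eq_div_iff hs]
        linear_combination hs'
    refine hfin.infinite_compl.mono fun s hs => ?_
    simp only [mem_compl_iff, mem_ofPred_eq] at hs ⊢
    set ξ := cα + s * sα with hξ
    set η := -sα + s * cα with hη
    have h1 : Polynomial.eval s ((linePoly P (fun i => Real.cos α * X i - Real.sin α * Y i)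
        (fun i => Real.sin α * X i + Real.cos α * Y i)).map (algebraMap ℝ ℂ)) =
        ξ ^ k * Polynomial.eval (η / ξ) p := by
      rw [Polynomial.eval_map_algebraMap, hp, Polynomial.eval_map_algebraMap,
        aeval_linePoly, aeval_linePoly, ← aeval_mul_of_isHomogeneous hP]
      congr 2
      ext i
      simp only [Complex.coe_algebraMap, Complex.ofReal_sub, Complex.ofReal_mul,
        Complex.ofReal_add, ← hcα, ← hsα]
      field_simp
      rw [hξ, hη]
      ring
    rw [h1, hsplit.eval_eq_prod_roots, Multiset.map_add, Multiset.prod_add, Multiset.map_map,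
      Multiset.map_replicate, Multiset.prod_replicate, Polynomial.eval_mul, Polynomial.eval_mul,
      Polynomial.eval_C, Polynomial.eval_pow]
    have h2 : Polynomial.eval s (rotFactor α (0, -1)) = ξ := by
      simp only [rotFactor, ← hcα, ← hsα, hξ, Polynomial.eval_add, Polynomial.eval_mul,
        Polynomial.eval_C, Polynomial.eval_X]
      ring
    have h3 : Polynomial.eval s (p.roots.map (rotFactor α ∘ fun T => ((1 : ℂ), T))).prod =
        ξ ^ p.natDegree * (p.roots.map (fun T => η / ξ - T)).prod := by
      rw [hsplit.natDegree_eq_card_roots, Polynomial.eval_multiset_prod, Multiset.map_map,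
        ← Multiset.card_map (fun T => η / ξ - T), ← Multiset.prod_replicate,
        Multiset.card_map, ← Multiset.map_const', ← Multiset.prod_map_mul]
      refine congrArg Multiset.prod (Multiset.map_congr rfl fun T _ => ?_)
      simp only [Function.comp_apply, rotFactor, ← hcα, ← hsα, Polynomial.eval_add,
        Polynomial.eval_mul, Polynomial.eval_C, Polynomial.eval_X]
      field_simp
      rw [hξ, hη]
      ring
    rw [h2, h3, show k = p.natDegree + (k - p.natDegree) by omega]
    rw [pow_add, Nat.add_sub_cancel_left]
    ring

/-- The logarithmic growth rate of the Taylor coefficients of `P x / P (x + s y)`, normalised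
so that it is nonpositive if all zeros have modulus at least `R`. -/
noncomputable def coeffPotential (P : MvPolynomial ι ℝ) (k : ℕ) (R : ℝ) (x y : ι → ℝ)
    (j : ℕ) : ℝ≥0∞ :=
  ENNReal.ofReal (Real.log R + (Real.log |invCoeff P x y j| - k * Real.log (j + 1)) / j)

/-- A measurable lower bound for `∑ log⁺ (R / |z|)` over the zeros `z` of `s ↦ P (x + s y)`. -/
noncomputable def zeroPotential (P : MvPolynomial ι ℝ) (k : ℕ) (R : ℝ) (x y : ι → ℝ) : ℝ≥0∞ :=
  ⨆ j, coeffPotential P k R x y j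

/-- `log (R / |z|)` for the zero `z` of `rotFactor α T`. -/
noncomputable def rotKernel (R α : ℝ) (T : ℂ × ℂ) : ℝ :=
  Real.log (R * (‖T.1 * Real.cos α - T.2 * Real.sin α‖ /
    ‖T.1 * Real.sin α + T.2 * Real.cos α‖))

lemma coeffPotential_le {P : MvPolynomial ι ℝ} {k : ℕ} {R : ℝ} (hR : 0 < R) (hR1 : R ≤ 1)
    {x y : ι → ℝ} {α : ℝ} {c : ℂ} {S : Multiset (ℂ × ℂ)} (hk : S.card = k)
    (hS : (linePoly P x y).map (algebraMap ℝ ℂ) = Polynomial.C c * (S.map (rotFactor α)).prod)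
    (j : ℕ) :
    coeffPotential P k R x y j ≤ (S.map fun T => ENNReal.ofReal (rotKernel R α T)).sum := by
  have hlogR : Real.log R ≤ 0 := Real.log_nonpos hR.le hR1
  rcases Nat.eq_zero_or_pos j with rfl | hj
  · simp [coeffPotential, ENNReal.ofReal_of_nonpos hlogR]
  by_cases hb : invCoeff P x y j = 0
  · rw [coeffPotential, ENNReal.ofReal_of_nonpos]
    · exact zero_le
    rw [hb, abs_zero, Real.log_zero, zero_sub]
    have : 0 ≤ Real.log ((j : ℝ) + 1) := Real.log_nonneg (by norm_cast; omega)
    have h2 : -(k * Real.log ((j : ℝ) + 1)) / j ≤ 0 :=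
      div_nonpos_of_nonpos_of_nonneg (by simp; positivity) (by positivity)
    linarith
  have hx : MvPolynomial.eval x P ≠ 0 := fun h => hb (by simp [invCoeff, h])
  set A : ℂ × ℂ → ℂ := fun T => T.1 * (Real.cos α : ℝ) - T.2 * (Real.sin α : ℝ) with hA
  set B : ℂ × ℂ → ℂ := fun T => T.1 * (Real.sin α : ℝ) + T.2 * (Real.cos α : ℝ) with hB
  have hfac : ∀ T, rotFactor α T = Polynomial.C (-B T) + Polynomial.X * Polynomial.C (A T) :=
    fun T => rfl
  have hx0 : ((MvPolynomial.eval x P : ℝ) : ℂ) = c * (S.map fun T => -B T).prod := by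
    have h := congrArg (Polynomial.eval 0) hS
    rw [Polynomial.eval_map_algebraMap, aeval_linePoly, Polynomial.eval_mul, Polynomial.eval_C,
      Polynomial.eval_multiset_prod, Multiset.map_map] at h
    have h2 : MvPolynomial.aeval (fun i => algebraMap ℝ ℂ (x i) + 0 * algebraMap ℝ ℂ (y i)) P
        = ((MvPolynomial.eval x P : ℝ) : ℂ) := by
      simp only [zero_mul, add_zero]
      exact MvPolynomial.aeval_algebraMap_apply (B := ℂ) x P
    rw [← h2, h]
    congr 2
    refine Multiset.map_congr rfl fun T _ => ?_
    simp [hfac]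
  have hxC : ((MvPolynomial.eval x P : ℝ) : ℂ) ≠ 0 := by exact_mod_cast hx
  have hBne : ∀ T ∈ S, B T ≠ 0 := by
    intro T hT h0
    apply hxC
    rw [hx0, Multiset.prod_eq_zero, mul_zero]
    rw [Multiset.mem_map]
    exact ⟨T, hT, by simp [h0]⟩
  set μ : ℂ × ℂ → ℂ := fun T => -(A T / B T) with hμ
  have hμn : ∀ T, ‖μ T‖ = ‖A T‖ / ‖B T‖ := fun T => by rw [hμ, norm_neg, norm_div]
  have hSeries : PowerSeries.map (algebraMap ℝ ℂ) (lineSeries P x y) =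
      PowerSeries.C ((MvPolynomial.eval x P : ℝ) : ℂ) *
        ((S.map μ).map fun ν => 1 + PowerSeries.X * PowerSeries.C ν).prod := by
    rw [← coe_linePoly, ← Polynomial.polynomial_map_coe, hS, Polynomial.coe_mul,
      Polynomial.coe_C, ← Polynomial.coeToPowerSeries.ringHom_apply (φ := (S.map (rotFactor α)).prod),
      map_multiset_prod, Multiset.map_map, Multiset.map_map, hx0, map_mul, mul_assoc,
      map_multiset_prod, Multiset.map_map, ← Multiset.prod_map_mul]
    refine congrArg _ (congrArg Multiset.prod (Multiset.map_congr rfl fun T hT => ?_))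
    have h1 : A T = -B T * μ T := by
      have := hBne T hT
      simp only [hμ]
      field_simp
    simp only [Function.comp_apply, hfac, Polynomial.coeToPowerSeries.ringHom_apply,
      Polynomial.coe_add, Polynomial.coe_mul, Polynomial.coe_C, Polynomial.coe_X]
    rw [h1, map_mul]
    ring
  obtain ⟨M, hM0, hMS, hMor⟩ : ∃ M : ℝ, 0 ≤ M ∧ (∀ T ∈ S, ‖μ T‖ ≤ M) ∧
      (M = 0 ∨ ∃ T ∈ S, M = ‖μ T‖) := by
    by_cases hS0 : S = 0
    · exact ⟨0, le_rfl, by simp [hS0], Or.inl rfl⟩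
    · obtain ⟨T₀, hT₀, hmax⟩ := S.exists_max_image (fun T => ‖μ T‖) hS0
      exact ⟨‖μ T₀‖, norm_nonneg _, hmax, Or.inr ⟨T₀, hT₀, rfl⟩⟩
  obtain ⟨g, hg, hgj⟩ := exists_inverse_prod_one_add (S.map μ) hM0 (by
    intro ν hν
    obtain ⟨T, hT, rfl⟩ := Multiset.mem_map.1 hν
    exact hMS T hT)
  have hbg : ((invCoeff P x y j : ℝ) : ℂ) = PowerSeries.coeff j g := by
    have h1 : lineSeries P x y * (lineSeries P x y)⁻¹ = 1 :=
      PowerSeries.mul_inv_cancel _ (by rwa [constantCoeff_lineSeries])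
    have h2 := congrArg (PowerSeries.map (algebraMap ℝ ℂ)) h1
    rw [map_mul, map_one, hSeries] at h2
    have h3 : PowerSeries.C ((MvPolynomial.eval x P : ℝ) : ℂ) *
        PowerSeries.map (algebraMap ℝ ℂ) (lineSeries P x y)⁻¹ = g := by
      calc _ = g * (PowerSeries.C ((MvPolynomial.eval x P : ℝ) : ℂ) *
            ((S.map μ).map fun ν => 1 + PowerSeries.X * PowerSeries.C ν).prod *
            PowerSeries.map (algebraMap ℝ ℂ) (lineSeries P x y)⁻¹) := by
            linear_combination (-(PowerSeries.C ((MvPolynomial.eval x P : ℝ) : ℂ) *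
              PowerSeries.map (algebraMap ℝ ℂ) (lineSeries P x y)⁻¹)) * hg
        _ = g := by rw [h2, mul_one]
    rw [← h3, PowerSeries.coeff_C_mul, invCoeff]
    simp
  have hle : |invCoeff P x y j| ≤ ((j : ℝ) + 1) ^ k * M ^ j := by
    rw [← Real.norm_eq_abs, ← Complex.norm_real, hbg, ← hk]
    simpa using hgj j
  have hbpos : 0 < |invCoeff P x y j| := abs_pos.2 hb
  have hM : 0 < M := by
    rcases hM0.eq_or_lt with h | h
    · rw [← h, zero_pow hj.ne', mul_zero] at hle
      exact absurd hbpos hle.not_gt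
    · exact h
  obtain ⟨T₀, hT₀, hMT⟩ := hMor.resolve_left hM.ne'
  have hlog : Real.log |invCoeff P x y j| ≤ k * Real.log (j + 1) + j * Real.log M := by
    refine (Real.log_le_log hbpos hle).trans_eq ?_
    rw [Real.log_mul (by positivity) (by positivity), Real.log_pow, Real.log_pow]
  refine le_trans ?_ (Multiset.single_le_sum (fun _ _ => zero_le) _
    (Multiset.mem_map_of_mem _ hT₀))
  refine ENNReal.ofReal_le_ofReal ?_
  have hK : rotKernel R α T₀ = Real.log R + Real.log M := by
    rw [← Real.log_mul hR.ne' hM.ne', hMT, hμn]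
    rfl
  rw [hK]
  gcongr
  rw [div_le_iff₀ (by positivity)]
  linarith

/-- The average of the potential of the zeros over all rotations of a plane. -/
lemma lintegral_zeroPotential_le {P : MvPolynomial ι ℝ} {k : ℕ} (hP : P.IsHomogeneous k)
    {R : ℝ} (hR : 0 < R) (hR1 : R ≤ 1) (X Y : ι → ℝ) :
    ∫⁻ α in Ioo (-(π / 2)) (π / 2), zeroPotential P k R
      (fun i => Real.cos α * X i - Real.sin α * Y i)
      (fun i => Real.sin α * X i + Real.cos α * Y i) ≤ k * ENNReal.ofReal (2 * R) := by
  obtain ⟨c, S, hSk, hS⟩ := exists_factorization hP X Y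
  have h1 : ∀ α, zeroPotential P k R (fun i => Real.cos α * X i - Real.sin α * Y i)
      (fun i => Real.sin α * X i + Real.cos α * Y i) ≤
      (S.map fun T => ENNReal.ofReal (rotKernel R α T)).sum := fun α =>
    iSup_le fun j => coeffPotential_le hR hR1 hSk (hS α) j
  refine (lintegral_mono h1).trans ?_
  rw [← hSk]
  clear h1 hS hSk
  induction S using Multiset.induction_on with
  | empty => simp
  | cons T S ih =>
    simp only [Multiset.map_cons, Multiset.sum_cons, Multiset.card_cons]
    rw [lintegral_add_left]
    · push_cast
      rw [add_mul, one_mul, add_comm]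
      exact add_le_add ih (lintegral_log_projective_le hR hR1)
    · unfold rotKernel
      fun_prop

end Roots

section LowerBound

lemma measurable_coeffPotential {ι Ω : Type*} [MeasurableSpace Ω] (P : MvPolynomial ι ℝ) (k : ℕ)
    (R : ℝ) {x y : Ω → ι → ℝ} (hx : ∀ i, Measurable fun q => x q i)
    (hy : ∀ i, Measurable fun q => y q i) (j : ℕ) :
    Measurable fun q => coeffPotential P k R (x q) (y q) j := by
  have := measurable_invCoeff P hx hy j
  unfold coeffPotential
  have h2 : Measurable fun q => Real.log |invCoeff P (x q) (y q) j| :=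
    Real.measurable_log.comp (measurable_abs.comp this)
  fun_prop

lemma measurable_zeroPotential {ι Ω : Type*} [MeasurableSpace Ω] (P : MvPolynomial ι ℝ) (k : ℕ)
    (R : ℝ) {x y : Ω → ι → ℝ} (hx : ∀ i, Measurable fun q => x q i)
    (hy : ∀ i, Measurable fun q => y q i) :
    Measurable fun q => zeroPotential P k R (x q) (y q) :=
  Measurable.iSup fun j => measurable_coeffPotential P k R hx hy j

lemma log_norm_eval_eq {T : Polynomial ℝ} {c : ℝ} (hc : T.eval c ≠ 0) :
    Real.log |T.eval c| = Real.log |T.leadingCoeff| +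
      ((T.map (algebraMap ℝ ℂ)).roots.map fun β => Real.log ‖(c : ℂ) - β‖).sum := by
  have hT : T ≠ 0 := by rintro rfl; simp at hc
  have hsplit := IsAlgClosed.splits (T.map (algebraMap ℝ ℂ))
  have h1 := hsplit.eval_eq_prod_roots (c : ℂ)
  have h2 : Polynomial.eval (c : ℂ) (T.map (algebraMap ℝ ℂ)) = ((T.eval c : ℝ) : ℂ) := by
    rw [Polynomial.eval_map_algebraMap]
    exact Polynomial.aeval_algebraMap_apply_eq_algebraMap_eval c T
  rw [h2, Polynomial.leadingCoeff_map] at h1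
  have hne : ∀ β ∈ (T.map (algebraMap ℝ ℂ)).roots, (c : ℂ) - β ≠ 0 := by
    intro β hβ h0
    rw [Multiset.prod_eq_zero (Multiset.mem_map.2 ⟨β, hβ, h0⟩), mul_zero] at h1
    exact hc (by exact_mod_cast h1)
  have h3 := congrArg (fun z => Real.log ‖z‖) h1
  simp only [norm_mul, Complex.norm_real, Real.norm_eq_abs, Complex.coe_algebraMap] at h3
  have hlist : ∀ M : Multiset ℂ, (∀ β ∈ M, (c : ℂ) - β ≠ 0) →
      0 < ‖(M.map fun β => (c : ℂ) - β).prod‖ ∧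
      Real.log ‖(M.map fun β => (c : ℂ) - β).prod‖ =
        (M.map fun β => Real.log ‖(c : ℂ) - β‖).sum := by
    intro M
    induction M using Multiset.induction_on with
    | empty => simp
    | cons β M ih =>
      intro hM
      obtain ⟨h5, h6⟩ := ih fun γ hγ => hM γ (Multiset.mem_cons_of_mem hγ)
      have h7 : 0 < ‖(c : ℂ) - β‖ := norm_pos_iff.2 (hM β (Multiset.mem_cons_self _ _))
      simp only [Multiset.map_cons, Multiset.prod_cons, Multiset.sum_cons, norm_mul]
      exact ⟨mul_pos h7 h5, by rw [Real.log_mul h7.ne' h5.ne', h6]⟩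
  obtain ⟨h5, h6⟩ := hlist _ hne
  rw [h3, Real.log_mul (by simpa using hT) h5.ne', h6]

/-- Averaging `log |T|` against a Gaussian: a polynomial of degree `j` loses at most a constant
multiple of `j` compared to its leading coefficient. -/
lemma ofReal_le_lintegral_gauss_log_eval {T : Polynomial ℝ} {j : ℕ} (hj : 0 < j)
    (hT : T.natDegree ≤ j) (hTj : T.coeff j ≠ 0) (b κ : ℝ) :
    ENNReal.ofReal (b + (Real.log |T.coeff j| - κ) / j - Real.log 2 - 1) ≤
      ∫⁻ c, ENNReal.ofReal (b + (Real.log |T.eval c| - κ) / j) ∂gauss ℝ := by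
  have hT0 : T ≠ 0 := by rintro rfl; simp at hTj
  have hdeg : T.natDegree = j := le_antisymm hT (Polynomial.le_natDegree_of_ne_zero hTj)
  have hlead : T.coeff j = T.leadingCoeff := by rw [← hdeg]; rfl
  have hj' : (0 : ℝ) < j := by exact_mod_cast hj
  set S := (T.map (algebraMap ℝ ℂ)).roots with hS
  have hcard : S.card = j := by
    rw [hS, ← (IsAlgClosed.splits _).natDegree_eq_card_roots, Polynomial.natDegree_map, hdeg]
  set s : ℝ → ℝ≥0∞ := fun c => (S.map fun β => ENNReal.ofReal (Real.log ((1 / 2) / ‖(c : ℂ) - β‖))).sum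
    with hs
  have hsall : ∀ M : Multiset ℂ, Measurable (fun c : ℝ =>
      (M.map fun β => ENNReal.ofReal (Real.log ((1 / 2) / ‖(c : ℂ) - β‖))).sum) ∧
      ∫⁻ c : ℝ, (M.map fun β => ENNReal.ofReal (Real.log ((1 / 2) / ‖(c : ℂ) - β‖))).sum
        ∂gauss ℝ ≤ M.card := by
    intro M
    induction M using Multiset.induction_on with
    | empty => simp
    | cons β M ih =>
      have hm : Measurable fun c : ℝ =>
          ENNReal.ofReal (Real.log ((1 / 2) / ‖(c : ℂ) - β‖)) := by fun_prop
      simp only [Multiset.map_cons, Multiset.sum_cons, Multiset.card_cons]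
      refine ⟨hm.add ih.1, ?_⟩
      rw [lintegral_add_left hm, add_comm]
      push_cast
      refine add_le_add ih.2 ((lintegral_gauss_log_div_norm_sub_le (by norm_num) β).trans ?_)
      norm_num
  have hsmeas : Measurable s := (hsall S).1
  have hsint : ∫⁻ c, s c ∂gauss ℝ ≤ j := by
    rw [← hcard]
    exact (hsall S).2
  have hpt : ∀ᵐ c ∂gauss ℝ, ENNReal.ofReal (b + (Real.log |T.coeff j| - κ) / j - Real.log 2) ≤
      ENNReal.ofReal (b + (Real.log |T.eval c| - κ) / j) + ENNReal.ofReal (1 / j) * s c := by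
    have hroots : {c | T.eval c = 0}.Countable := by
      refine ((T.roots.toFinset.finite_toSet).subset fun c hc => ?_).countable
      simpa [hT0] using hc
    filter_upwards [gauss_absolutelyContinuous.ae_le (hroots.ae_notMem volume)] with c hc
    have hne : ∀ β ∈ S, 0 < ‖(c : ℂ) - β‖ := by
      intro β hβ
      rw [norm_pos_iff, sub_ne_zero]
      rintro rfl
      have h1 := (Polynomial.mem_roots'.1 hβ).2
      rw [Polynomial.IsRoot, Polynomial.eval_map_algebraMap] at h1
      have h2 := Polynomial.aeval_algebraMap_apply_eq_algebraMap_eval (A := ℂ) c T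
      rw [Complex.coe_algebraMap, h1] at h2
      exact hc (by exact_mod_cast h2.symm)
    have hsum : ∀ M : Multiset ℂ, (∀ β ∈ M, 0 < ‖(c : ℂ) - β‖) →
        ENNReal.ofReal (-(M.card * Real.log 2) - (M.map fun β => Real.log ‖(c : ℂ) - β‖).sum) ≤
        (M.map fun β => ENNReal.ofReal (Real.log ((1 / 2) / ‖(c : ℂ) - β‖))).sum := by
      intro M
      induction M using Multiset.induction_on with
      | empty => simp
      | cons β M ih =>
        intro hM
        have h1 := ih fun γ hγ => hM γ (Multiset.mem_cons_of_mem hγ)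
        have h2 := hM β (Multiset.mem_cons_self _ _)
        simp only [Multiset.map_cons, Multiset.sum_cons, Multiset.card_cons]
        refine le_trans (le_of_eq ?_) (ENNReal.ofReal_add_le.trans (add_le_add le_rfl h1))
        rw [Real.log_div (by norm_num) h2.ne', one_div, Real.log_inv]
        push_cast
        ring_nf
    have h1 := log_norm_eval_eq hc
    rw [hlead, h1]
    have h2 := hsum S hne
    rw [hcard] at h2
    refine le_trans ?_ (add_le_add le_rfl (mul_le_mul_right h2 _))
    rw [← ENNReal.ofReal_mul (by positivity)]
    refine le_trans (le_of_eq ?_) ENNReal.ofReal_add_le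
    congr 1
    field_simp
    ring
  have hfin := lintegral_mono_ae hpt
  rw [lintegral_const, measure_univ, mul_one, lintegral_add_right _ (hsmeas.const_mul _),
    lintegral_const_mul _ hsmeas] at hfin
  rw [ENNReal.ofReal_sub _ zero_le_one, tsub_le_iff_right, ENNReal.ofReal_one]
  refine hfin.trans (add_le_add le_rfl ?_)
  calc ENNReal.ofReal (1 / j) * ∫⁻ c, s c ∂gauss ℝ ≤ ENNReal.ofReal (1 / j) * (j : ℝ≥0∞) := by
        gcongr
    _ = 1 := by
        rw [← ENNReal.ofReal_natCast, ← ENNReal.ofReal_mul (by positivity),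
          one_div, inv_mul_cancel₀ hj'.ne', ENNReal.ofReal_one]

variable {n : ℕ}

lemma measurable_ofLp_apply (i : Fin n) :
    Measurable fun y : EuclideanSpace ℝ (Fin n) => y.ofLp i := by
  fun_prop

lemma coeffPotential_average {P : MvPolynomial (Fin (n + 1)) ℝ} {k : ℕ} {R : ℝ}
    {x u : EuclideanSpace ℝ (Fin (n + 1))} (hx : MvPolynomial.eval x.ofLp P ≠ 0)
    (hu : ‖u‖ = 1) {j : ℕ} (hj : 0 < j) (hb : invCoeff P x.ofLp u.ofLp j ≠ 0) :
    ENNReal.ofReal (Real.log R + (Real.log |invCoeff P x.ofLp u.ofLp j| -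
      k * Real.log (j + 1)) / j - Real.log 2 - 1) ≤
    ∫⁻ y, coeffPotential P k R x.ofLp y.ofLp j ∂gauss (EuclideanSpace ℝ (Fin (n + 1))) := by
  obtain ⟨φ, -, hφ⟩ := exists_split (E := EuclideanSpace ℝ (Fin (n + 1))) (m := n) (by simp) hu
  have hmeas : Measurable fun y : EuclideanSpace ℝ (Fin (n + 1)) =>
      coeffPotential P k R x.ofLp y.ofLp j :=
    by
    have h := measurable_coeffPotential (Ω := EuclideanSpace ℝ (Fin (n + 1))) P k R
      (x := fun _ => x.ofLp) (y := fun y => y.ofLp)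
      (fun i => by exact measurable_const) (fun i => by exact measurable_ofLp_apply i) j
    exact h
  have hmeas2 := hmeas.comp hφ.measurable
  simp only [Function.comp_def] at hmeas2
  rw [← hφ.lintegral_comp hmeas, lintegral_prod_symm _ hmeas2.aemeasurable]
  have : ∀ v : EuclideanSpace ℝ (Fin n), ENNReal.ofReal (Real.log R +
      (Real.log |invCoeff P x.ofLp u.ofLp j| - k * Real.log (j + 1)) / j - Real.log 2 - 1) ≤
      ∫⁻ c, coeffPotential P k R x.ofLp (c • u + φ v).ofLp j ∂gauss ℝ := by
    intro v
    obtain ⟨T, hT1, hT2, hT3⟩ := exists_poly_invCoeff hx u.ofLp (φ v).ofLp j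
    rw [← hT2]
    refine (ofReal_le_lintegral_gauss_log_eval hj hT1 (by rwa [hT2]) _ _).trans_eq
      (lintegral_congr fun c => ?_)
    have hv : (c • u + φ v).ofLp = fun i => c * u.ofLp i + (φ v).ofLp i := by
      ext i
      simp
    rw [coeffPotential, hT3, hv]
  refine le_trans (le_of_eq ?_) (lintegral_mono this)
  rw [lintegral_const, measure_univ, mul_one]

/-- If `P` vanishes at distance `‖w‖` from `x`, then the zeros of `s ↦ P (x + s y)` are on
average, in the logarithmic sense, not much farther from the origin than `‖w‖`. -/
lemma le_lintegral_zeroPotential {P : MvPolynomial (Fin (n + 1)) ℝ} {k : ℕ} {R : ℝ}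
    {x w : EuclideanSpace ℝ (Fin (n + 1))} (hx : MvPolynomial.eval x.ofLp P ≠ 0)
    (hw : MvPolynomial.eval (x + w).ofLp P = 0) :
    ENNReal.ofReal (Real.log R - Real.log ‖w‖ - Real.log 2 - 1) ≤
    ∫⁻ y, zeroPotential P k R x.ofLp y.ofLp ∂gauss (EuclideanSpace ℝ (Fin (n + 1))) := by
  have hw0 : w ≠ 0 := by
    rintro rfl
    rw [add_zero] at hw
    exact hx hw
  have hr : 0 < ‖w‖ := norm_pos_iff.2 hw0
  set I := ∫⁻ y, zeroPotential P k R x.ofLp y.ofLp ∂gauss (EuclideanSpace ℝ (Fin (n + 1)))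
    with hI
  have key : ∀ δ > 0, ENNReal.ofReal (Real.log R - Real.log ‖w‖ - Real.log 2 - 1 - 2 * δ) ≤ I := by
    intro δ hδ
    have hlim : Filter.Tendsto (fun j : ℕ => (k : ℝ) * Real.log (j + 1) / j) Filter.atTop
        (nhds 0) := by
      have h1 := (Real.tendsto_pow_log_div_mul_add_atTop 1 (-1) 1 one_ne_zero).comp
        (Filter.tendsto_atTop_add_const_right Filter.atTop (1 : ℝ) tendsto_natCast_atTop_atTop)
      have h2 := h1.const_mul (k : ℝ)
      rw [mul_zero] at h2
      refine h2.congr fun j => ?_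
      simp [mul_div_assoc]
    obtain ⟨J, hJ⟩ := Filter.eventually_atTop.1 ((tendsto_order.1 hlim).2 δ hδ)
    obtain ⟨j, hjJ, hj⟩ := exists_pow_le_abs_invCoeff (P := P) (x := x.ofLp)
      (u := (‖w‖⁻¹ • w).ofLp) (ρ := ‖w‖ * Real.exp δ) hx hr
      (lt_mul_of_one_lt_right hr (Real.one_lt_exp_iff.2 hδ)) (by
        rw [← hw]
        congr 2
        ext i
        simp [mul_inv_cancel_left₀ hr.ne']) (max J 1)
    have hj1 : 0 < j := (le_max_right J 1).trans hjJ
    have hj1' : (0 : ℝ) < j := by exact_mod_cast hj1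
    have hpos : 0 < ((‖w‖ * Real.exp δ)⁻¹) ^ j := by positivity
    have havg := coeffPotential_average (k := k) (R := R) hx (u := ‖w‖⁻¹ • w)
      (by rw [norm_smul, norm_inv, norm_norm, inv_mul_cancel₀ hr.ne']) hj1
      (abs_pos.1 (hpos.trans_le hj))
    refine le_trans (ENNReal.ofReal_le_ofReal ?_) (havg.trans
      (lintegral_mono fun y => le_iSup (fun j => coeffPotential P k R x.ofLp y.ofLp j) j))
    have h1 := Real.log_le_log hpos hj
    rw [Real.log_pow, Real.log_inv, Real.log_mul hr.ne' (Real.exp_pos _).ne', Real.log_exp] at h1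
    have h2 := hJ j ((le_max_left J 1).trans hjJ)
    have h3 : -(Real.log ‖w‖ + δ) - k * Real.log (j + 1) / j ≤
        (Real.log |invCoeff P x.ofLp (‖w‖⁻¹ • w).ofLp j| - k * Real.log (j + 1)) / j := by
      rw [sub_div]
      gcongr
      rw [le_div_iff₀ hj1']
      linarith
    linarith
  by_cases hIt : I = ⊤
  · simp [hIt]
  rw [ENNReal.ofReal_le_iff_le_toReal hIt]
  refine le_of_forall_pos_le_add fun δ hδ => ?_
  have := (ENNReal.ofReal_le_iff_le_toReal hIt).1 (key (δ / 2) (by positivity))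
  linarith

end LowerBound

section Uniqueness

variable {E : Type*} [NormedAddCommGroup E] [InnerProductSpace ℝ E]
    [FiniteDimensional ℝ E] [MeasurableSpace E] [BorelSpace E]

lemma exists_linearIsometryEquiv_apply_eq {v w : E} (h : ‖v‖ = ‖w‖) :
    ∃ L : E ≃ₗᵢ[ℝ] E, L v = w :=
  ⟨_, Submodule.reflection_sub h⟩

lemma charFun_eq_of_norm_eq {μ : Measure E}
    (hμ : ∀ L : E ≃ₗᵢ[ℝ] E, μ.map L = μ) {v w : E} (h : ‖v‖ = ‖w‖) :
    charFun μ v = charFun μ w := by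
  obtain ⟨L, rfl⟩ := exists_linearIsometryEquiv_apply_eq h
  conv_rhs => rw [← hμ L]
  rw [charFun_apply, charFun_apply, integral_map (by fun_prop) (by fun_prop)]
  simp

/-- Two finite rotation invariant measures on the unit sphere are proportional. -/
theorem smul_eq_smul_of_rotation_invariant (μ ν : Measure E) [IsFiniteMeasure μ]
    [IsFiniteMeasure ν] (hμ : ∀ L : E ≃ₗᵢ[ℝ] E, μ.map L = μ)
    (hν : ∀ L : E ≃ₗᵢ[ℝ] E, ν.map L = ν) (hμs : ∀ᵐ x ∂μ, ‖x‖ = 1) (hνs : ∀ᵐ x ∂ν, ‖x‖ = 1) :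
    ν univ • μ = μ univ • ν := by
  have : IsFiniteMeasure (ν univ • μ) := Measure.smul_finite μ (measure_ne_top ν univ)
  have : IsFiniteMeasure (μ univ • ν) := Measure.smul_finite ν (measure_ne_top μ univ)
  apply Measure.ext_of_charFun
  funext t
  have h1 : charFun (ν univ • μ) t = ∫ θ, charFun μ (‖t‖ • θ) ∂ν := by
    have : ∀ᵐ θ ∂ν, charFun μ (‖t‖ • θ) = charFun μ t := by
      filter_upwards [hνs] with θ hθ
      exact charFun_eq_of_norm_eq hμ (by rw [norm_smul, hθ, norm_norm, mul_one])
    rw [integral_congr_ae this, integral_const, charFun_apply, charFun_apply,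
      integral_smul_measure]
    rfl
  have h2 : charFun (μ univ • ν) t = ∫ x, charFun ν (‖t‖ • x) ∂μ := by
    have : ∀ᵐ θ ∂μ, charFun ν (‖t‖ • θ) = charFun ν t := by
      filter_upwards [hμs] with θ hθ
      exact charFun_eq_of_norm_eq hν (by rw [norm_smul, hθ, norm_norm, mul_one])
    rw [integral_congr_ae this, integral_const, charFun_apply, charFun_apply,
      integral_smul_measure]
    rfl
  rw [h1, h2]
  simp_rw [charFun_apply]
  rw [integral_integral_swap]
  · refine integral_congr_ae (Filter.Eventually.of_forall fun x => ?_)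
    refine integral_congr_ae (Filter.Eventually.of_forall fun y => ?_)
    simp only [inner_smul_right, real_inner_comm x y]
  · refine Integrable.of_bound (C := 1) (by
      simp only [Function.uncurry_def]
      fun_prop) (Filter.Eventually.of_forall fun p => ?_)
    simp only [Function.uncurry_def]
    rw [Complex.norm_exp_ofReal_mul_I]

lemma map_gauss (L : E ≃ₗᵢ[ℝ] E) : (gauss E).map L = gauss E := by
  ext s hs
  rw [Measure.map_apply (by fun_prop) hs, ← lintegral_indicator_one (L.continuous.measurable hs),
    ← lintegral_indicator_one hs, lintegral_gauss, lintegral_gauss]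
  conv_rhs => rw [← L.measurePreserving.lintegral_comp_emb L.toHomeomorph.measurableEmbedding]
  refine lintegral_congr fun x => ?_
  rw [gaussDensity, gaussDensity, L.norm_map]
  rfl

/-- The radial projection onto the unit sphere. -/
noncomputable def normalize (x : E) : E := ‖x‖⁻¹ • x

lemma measurable_normalize : Measurable (normalize : E → E) := by
  unfold normalize
  fun_prop

lemma norm_normalize {x : E} (hx : x ≠ 0) : ‖normalize x‖ = 1 := by
  rw [normalize, norm_smul, norm_inv, norm_norm, inv_mul_cancel₀ (norm_ne_zero_iff.2 hx)]

lemma ae_gauss_ne_zero [Nontrivial E] : ∀ᵐ x ∂gauss E, x ≠ 0 := by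
  refine gauss_absolutelyContinuous.ae_le ?_
  exact ((countable_singleton (0 : E)).ae_notMem volume)

/-- The radially weighted Gaussian measure, projected to the unit sphere. -/
noncomputable def radialMeasure (E : Type*) [NormedAddCommGroup E] [InnerProductSpace ℝ E]
    [FiniteDimensional ℝ E] [MeasurableSpace E] [BorelSpace E] (f : ℝ → ℝ≥0∞) : Measure E :=
  ((gauss E).withDensity fun x => f ‖x‖).map normalize

lemma radialMeasure_apply {f : ℝ → ℝ≥0∞} {s : Set E} (hs : MeasurableSet s) :
    radialMeasure E f s = ∫⁻ x in normalize ⁻¹' s, f ‖x‖ ∂gauss E := by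
  rw [radialMeasure, Measure.map_apply measurable_normalize hs,
    withDensity_apply _ (measurable_normalize hs)]

lemma isFiniteMeasure_radialMeasure {f : ℝ → ℝ≥0∞} {C : ℝ≥0∞} (hC : C ≠ ⊤) (hf : ∀ r, f r ≤ C) :
    IsFiniteMeasure (radialMeasure E f) := by
  refine ⟨?_⟩
  rw [radialMeasure_apply MeasurableSet.univ]
  calc _ ≤ ∫⁻ x in normalize ⁻¹' univ, C ∂gauss E := lintegral_mono fun x => hf _
    _ < ⊤ := by
      rw [lintegral_const]
      exact ENNReal.mul_lt_top hC.lt_top (measure_lt_top _ _)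

lemma map_radialMeasure {f : ℝ → ℝ≥0∞} (hf : Measurable f) (L : E ≃ₗᵢ[ℝ] E) :
    (radialMeasure E f).map L = radialMeasure E f := by
  ext s hs
  rw [Measure.map_apply (by fun_prop) hs, radialMeasure_apply hs,
    radialMeasure_apply (L.continuous.measurable hs)]
  have hmp : MeasurePreserving L (gauss E) (gauss E) := ⟨by fun_prop, map_gauss L⟩
  have hpre : normalize ⁻¹' (L ⁻¹' s) = L ⁻¹' (normalize ⁻¹' s) := by
    ext x
    simp [normalize]
  rw [hpre, ← hmp.setLIntegral_comp_preimage (measurable_normalize hs) (by fun_prop)]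
  simp

lemma ae_radialMeasure_norm [Nontrivial E] {f : ℝ → ℝ≥0∞} :
    ∀ᵐ x ∂radialMeasure E f, ‖x‖ = 1 := by
  rw [radialMeasure, ae_map_iff measurable_normalize.aemeasurable
    (measurableSet_eq_fun measurable_norm measurable_const)]
  refine (withDensity_absolutelyContinuous _ _).ae_le ?_
  filter_upwards [ae_gauss_ne_zero] with x hx using norm_normalize hx

/-- Independence of the radial and angular parts of a Gaussian vector. -/
lemma setLIntegral_gauss_radial [Nontrivial E] {f : ℝ → ℝ≥0∞} (hf : Measurable f) {C : ℝ≥0∞}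
    (hC : C ≠ ⊤) (hfC : ∀ r, f r ≤ C) {s : Set E} (hs : MeasurableSet s) :
    ∫⁻ x in normalize ⁻¹' s, f ‖x‖ ∂gauss E =
      gauss E (normalize ⁻¹' s) * ∫⁻ x, f ‖x‖ ∂gauss E := by
  have := isFiniteMeasure_radialMeasure (E := E) hC hfC
  have := isFiniteMeasure_radialMeasure (E := E) (f := fun _ => 1) ENNReal.one_ne_top
    fun _ => le_rfl
  have h := smul_eq_smul_of_rotation_invariant (radialMeasure E f) (radialMeasure E fun _ => 1)
    (map_radialMeasure hf) (map_radialMeasure measurable_const) ae_radialMeasure_norm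
    ae_radialMeasure_norm
  have h2 := DFunLike.congr_fun h s
  rw [Measure.smul_apply, Measure.smul_apply, radialMeasure_apply hs, radialMeasure_apply hs,
    radialMeasure_apply MeasurableSet.univ, radialMeasure_apply MeasurableSet.univ] at h2
  simp only [preimage_univ, Measure.restrict_univ, lintegral_const, measure_univ, mul_one,
    smul_eq_mul, one_mul, Measure.restrict_apply_univ] at h2
  rw [h2, mul_comm]

variable {n : ℕ}

lemma measurableSet_cap (a : EuclideanSpace ℝ (Fin (n + 1))) (σ : ℝ) :
    MeasurableSet (cap n a σ) := by
  refine Metric.isClosed_sphere.measurableSet.inter ?_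
  exact measurableSet_lt measurable_const
    (show Measurable fun z : EuclideanSpace ℝ (Fin (n + 1)) => ⟪z, a⟫ from by fun_prop)

lemma hausdorff_cap_eq {a b : EuclideanSpace ℝ (Fin (n + 1))} (h : ‖a‖ = ‖b‖) (σ : ℝ) :
    μH[(n : ℝ)] (cap n a σ) = μH[(n : ℝ)] (cap n b σ) := by
  obtain ⟨L, rfl⟩ := exists_linearIsometryEquiv_apply_eq h
  have h1 := (L.toIsometryEquiv.measurePreserving_hausdorffMeasure (n : ℝ)).measure_preimage
    (measurableSet_cap (L a) σ).nullMeasurableSet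
  rw [← h1]
  congr 1
  ext x
  simp [cap]

/-- Comparing Gaussian measures of cones suffices to bound `nuMeasure`. -/
lemma nuMeasure_le_of_gauss_le {a : EuclideanSpace ℝ (Fin (n + 1))} (ha : ‖a‖ = 1) {σ : ℝ}
    (hσ : σ ∈ Ioc (0 : ℝ) 1) {T : Set (EuclideanSpace ℝ (Fin (n + 1)))} (hT : MeasurableSet T)
    {C : ℝ≥0∞} (h : gauss (EuclideanSpace ℝ (Fin (n + 1))) (normalize ⁻¹' (T ∩ cap n a σ)) ≤
      C * gauss (EuclideanSpace ℝ (Fin (n + 1))) (normalize ⁻¹' (cap n a σ))) :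
    nuMeasure n a σ T ≤ C := by
  rw [nuMeasure, Measure.smul_apply, Measure.restrict_apply hT, smul_eq_mul]
  by_cases h0 : μH[(n : ℝ)] (cap n a σ) = 0
  · rw [measure_mono_null inter_subset_right h0, mul_zero]
    exact zero_le
  by_cases htop : μH[(n : ℝ)] (cap n a σ) = ⊤
  · rw [htop, ENNReal.inv_top, zero_mul]
    exact zero_le
  set s := Metric.sphere (0 : EuclideanSpace ℝ (Fin (n + 1))) 1 with hs
  have hsm : MeasurableSet s := Metric.isClosed_sphere.measurableSet
  have hsfin : μH[(n : ℝ)] s < ⊤ := by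
    refine (isCompact_sphere _ _).measure_lt_top_of_nhdsWithin fun z hz => ?_
    have hz1 : ‖z‖ = 1 := by simpa using hz
    refine ⟨cap n z σ, ?_, ?_⟩
    · refine inter_mem_nhdsWithin s ?_
      refine (isOpen_lt continuous_const (show Continuous fun w => ⟪w, z⟫ from by fun_prop)).mem_nhds ?_
      show Real.sqrt (1 - σ ^ 2) < ⟪z, z⟫
      rw [real_inner_self_eq_norm_sq, hz1, Real.sqrt_lt' (by norm_num)]
      nlinarith [hσ.1]
    · rw [hausdorff_cap_eq (hz1.trans ha.symm)]
      exact lt_top_iff_ne_top.2 htop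
  set μ := (μH[(n : ℝ)] : Measure (EuclideanSpace ℝ (Fin (n + 1)))).restrict s with hμ
  have hμfin : IsFiniteMeasure μ := ⟨by rwa [hμ, Measure.restrict_apply_univ]⟩
  have hμinv : ∀ L : EuclideanSpace ℝ (Fin (n + 1)) ≃ₗᵢ[ℝ] EuclideanSpace ℝ (Fin (n + 1)),
      μ.map L = μ := by
    intro L
    have h1 := (L.toIsometryEquiv.measurePreserving_hausdorffMeasure (n : ℝ)).restrict_preimage hsm
    have h2 : L.toIsometryEquiv ⁻¹' s = s := by
      ext x; simp [hs]
    rw [h2] at h1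
    exact h1.map_eq
  have hμs : ∀ᵐ x ∂μ, ‖x‖ = 1 := by
    filter_upwards [ae_restrict_mem hsm] with x hx
    simpa [hs] using hx
  have := isFiniteMeasure_radialMeasure (E := EuclideanSpace ℝ (Fin (n + 1))) (f := fun _ => 1)
    ENNReal.one_ne_top fun _ => le_rfl
  have hprop := smul_eq_smul_of_rotation_invariant μ (radialMeasure _ fun _ => 1) hμinv
    (map_radialMeasure measurable_const) hμs ae_radialMeasure_norm
  have key : ∀ A, MeasurableSet A → A ⊆ s → μH[(n : ℝ)] A =
      μ univ * gauss (EuclideanSpace ℝ (Fin (n + 1))) (normalize ⁻¹' A) := by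
    intro A hA hAs
    have h2 := DFunLike.congr_fun hprop A
    rw [Measure.smul_apply, Measure.smul_apply, radialMeasure_apply hA,
      radialMeasure_apply MeasurableSet.univ] at h2
    simp only [preimage_univ, Measure.restrict_univ, lintegral_const, measure_univ, mul_one,
      smul_eq_mul, one_mul, Measure.restrict_apply_univ] at h2
    rw [← h2, hμ, Measure.restrict_apply hA, inter_eq_self_of_subset_left hAs]
  have hcaps : cap n a σ ⊆ s := fun x hx => hx.1
  rw [mul_comm, ← div_eq_mul_inv, ENNReal.div_le_iff h0 htop,
    key _ (hT.inter (measurableSet_cap a σ)) (inter_subset_right.trans hcaps),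
    key _ (measurableSet_cap a σ) hcaps, mul_left_comm]
  exact mul_le_mul_right h _

end Uniqueness

section PolarSplit

/-- A standard Gaussian vector in the plane, in polar coordinates. -/
lemma lintegral_gauss_polar {K : ℝ × ℝ → ℝ≥0∞} (hK : Measurable K) :
    ∫⁻ p, K p ∂(gauss ℝ).prod (gauss ℝ) =
      ∫⁻ ρ in Ioi (0 : ℝ), ∫⁻ α in Ioo (-π) π,
        ENNReal.ofReal (ρ * rexp (-π * ρ ^ 2)) * K (ρ * Real.cos α, ρ * Real.sin α) := by
  have hg : Measurable fun p : ℝ × ℝ => gaussDensity p.1 * gaussDensity p.2 :=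
    (measurable_gaussDensity.comp measurable_fst).mul (measurable_gaussDensity.comp measurable_snd)
  rw [gauss_prod_eq, lintegral_withDensity_eq_lintegral_mul _ hg hK,
    show ((volume : Measure ℝ).prod (volume : Measure ℝ)) = volume from rfl,
    ← lintegral_comp_polarCoord_symm, polarCoord_target, Measure.volume_eq_prod,
    ← Measure.prod_restrict, lintegral_prod]
  · refine setLIntegral_congr_fun measurableSet_Ioi fun ρ (hρ : 0 < ρ) => ?_
    refine lintegral_congr fun α => ?_
    simp only [polarCoord_symm_apply, Pi.mul_apply, smul_eq_mul, gaussDensity, Real.norm_eq_abs,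
      sq_abs]
    rw [← mul_assoc, ← ENNReal.ofReal_mul (Real.exp_pos _).le, ← Real.exp_add,
      ← ENNReal.ofReal_mul hρ.le]
    congr 4
    linear_combination -(π * ρ ^ 2) * Real.sin_sq_add_cos_sq α
  · have h1 : Measurable (polarCoord.symm : ℝ × ℝ → ℝ × ℝ) := by
      have : (polarCoord.symm : ℝ × ℝ → ℝ × ℝ) =
        fun p => (p.1 * Real.cos p.2, p.1 * Real.sin p.2) := by
        funext p; exact polarCoord_symm_apply p
      rw [this]
      fun_prop
    have h2 := (hg.mul hK).comp h1
    exact ((measurable_fst.ennreal_ofReal).mul h2).aemeasurable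

variable {E : Type*} [NormedAddCommGroup E] [InnerProductSpace ℝ E]
    [FiniteDimensional ℝ E] [MeasurableSpace E] [BorelSpace E]

/-- Joint law of two independent Gaussian vectors: polar coordinates for the pair of coordinates
along `a`, and a rotation of the pair of orthogonal components. -/
lemma lintegral_gauss_pair {m : ℕ} {a : E} {ι : EuclideanSpace ℝ (Fin m) →ₗᵢ[ℝ] E}
    (hι : MeasurePreserving (fun p : ℝ × EuclideanSpace ℝ (Fin m) => p.1 • a + ι p.2)
        ((gauss ℝ).prod (gauss (EuclideanSpace ℝ (Fin m)))) (gauss E))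
    {H : E × E → ℝ≥0∞} (hH : Measurable H) :
    ∫⁻ x, ∫⁻ y, H (x, y) ∂gauss E ∂gauss E =
      ∫⁻ y' : EuclideanSpace ℝ (Fin m), ∫⁻ x' : EuclideanSpace ℝ (Fin m),
        (∫⁻ ρ in Ioi (0 : ℝ), ∫⁻ α in Ioo (-π) π, ENNReal.ofReal (ρ * rexp (-π * ρ ^ 2)) *
          H (Real.cos α • (ρ • a + ι x') - Real.sin α • ι y',
            Real.sin α • (ρ • a + ι x') + Real.cos α • ι y'))
        ∂gauss _ ∂gauss _ := by
  have hιm : Measurable ι := ι.continuous.measurable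
  set F := EuclideanSpace ℝ (Fin m) with hF
  let J : ℝ × ℝ → F × F → ℝ≥0∞ := fun p q => H (p.1 • a + ι q.1, p.2 • a + ι q.2)
  have hJ : Measurable fun z : (ℝ × ℝ) × (F × F) => J z.1 z.2 := by
    refine hH.comp ?_
    fun_prop
  let L : (F × F) × (ℝ × ℝ) → ℝ≥0∞ := fun z => ENNReal.ofReal (z.2.1 * rexp (-π * z.2.1 ^ 2)) *
    H (Real.cos z.2.2 • (z.2.1 • a + ι z.1.1) - Real.sin z.2.2 • ι z.1.2,
      Real.sin z.2.2 • (z.2.1 • a + ι z.1.1) + Real.cos z.2.2 • ι z.1.2)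
  have hL : Measurable L := by
    refine Measurable.mul (by fun_prop) (hH.comp ?_)
    fun_prop
  calc ∫⁻ x, ∫⁻ y, H (x, y) ∂gauss E ∂gauss E
      = ∫⁻ x0, ∫⁻ x', ∫⁻ y0, ∫⁻ y', J (x0, y0) (x', y') ∂gauss F ∂gauss ℝ ∂gauss F ∂gauss ℝ := by
        rw [← hι.lintegral_comp hH.lintegral_prod_right', lintegral_prod]
        · refine lintegral_congr fun x0 => lintegral_congr fun x' => ?_
          have : Measurable fun y => H (x0 • a + ι x', y) := hH.comp (by fun_prop)
          rw [← hι.lintegral_comp this, lintegral_prod]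
          exact (this.comp (by fun_prop)).aemeasurable
        · exact (hH.lintegral_prod_right'.comp (by fun_prop)).aemeasurable
    _ = ∫⁻ x0, ∫⁻ y0, ∫⁻ x', ∫⁻ y', J (x0, y0) (x', y') ∂gauss F ∂gauss F ∂gauss ℝ ∂gauss ℝ := by
        refine lintegral_congr fun x0 => ?_
        rw [lintegral_lintegral_swap]
        refine Measurable.aemeasurable ?_
        have : Measurable fun z : (F × ℝ) × F => J (x0, z.1.2) (z.1.1, z.2) :=
          hJ.comp (by fun_prop : Measurable fun z : (F × ℝ) × F => ((x0, z.1.2), (z.1.1, z.2)))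
        exact this.lintegral_prod_right'
    _ = ∫⁻ p, ∫⁻ q, J p q ∂(gauss F).prod (gauss F) ∂(gauss ℝ).prod (gauss ℝ) := by
        rw [lintegral_prod]
        · refine lintegral_congr fun x0 => lintegral_congr fun y0 => ?_
          rw [lintegral_prod]
          exact (hJ.comp (by fun_prop : Measurable fun q : F × F => ((x0, y0), q))).aemeasurable
        · exact hJ.lintegral_prod_right'.aemeasurable
    _ = ∫⁻ ρ in Ioi (0 : ℝ), ∫⁻ α in Ioo (-π) π, ∫⁻ q, L (q, (ρ, α)) ∂(gauss F).prod (gauss F) := by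
        rw [lintegral_gauss_polar hJ.lintegral_prod_right']
        refine lintegral_congr fun ρ => lintegral_congr fun α => ?_
        have hm : Measurable fun q => J (ρ * Real.cos α, ρ * Real.sin α) q :=
          hJ.comp (by fun_prop :
            Measurable fun q : F × F => ((ρ * Real.cos α, ρ * Real.sin α), q))
        rw [← (measurePreserving_rotation (E := F) (Real.cos_sq_add_sin_sq α)).lintegral_comp hm,
          ← lintegral_const_mul' _ _ ENNReal.ofReal_ne_top]
        refine lintegral_congr fun q => ?_
        simp only [J, L]
        congr 3
        · simp only [map_sub, map_smul]
          module
        · simp only [map_add, map_smul]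
          module
    _ = ∫⁻ q, (∫⁻ ρ in Ioi (0 : ℝ), ∫⁻ α in Ioo (-π) π, L (q, (ρ, α)))
          ∂(gauss F).prod (gauss F) := by
        symm
        rw [lintegral_lintegral_swap]
        · refine lintegral_congr fun ρ => ?_
          rw [lintegral_lintegral_swap]
          exact (hL.comp (by fun_prop :
            Measurable fun z : (F × F) × ℝ => (z.1, (ρ, z.2)))).aemeasurable
        · have := hL.comp (by fun_prop :
            Measurable fun z : ((F × F) × ℝ) × ℝ => (z.1.1, (z.1.2, z.2)))
          exact this.lintegral_prod_right'.aemeasurable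
    _ = _ := by
        rw [lintegral_prod_symm]
        have := hL.comp (by fun_prop :
          Measurable fun z : ((F × F) × ℝ) × ℝ => (z.1.1, (z.1.2, z.2)))
        exact this.lintegral_prod_right'.lintegral_prod_right'.aemeasurable

end PolarSplit

section UpperBound

variable {n : ℕ}

lemma mem_preimage_cap_iff {a x : EuclideanSpace ℝ (Fin (n + 1))} {σ : ℝ} :
    x ∈ normalize ⁻¹' cap n a σ ↔ Real.sqrt (1 - σ ^ 2) * ‖x‖ < ⟪x, a⟫ := by
  rcases eq_or_ne x 0 with rfl | hx
  · simp [cap, normalize]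
  · have hx' : 0 < ‖x‖ := norm_pos_iff.2 hx
    have h1 : normalize x ∈ Metric.sphere (0 : EuclideanSpace ℝ (Fin (n + 1))) 1 := by
      simpa using norm_normalize hx
    have h2 : ⟪normalize x, a⟫ = ⟪x, a⟫ / ‖x‖ := by
      rw [normalize, real_inner_smul_left, inv_mul_eq_div]
    rw [← lt_div_iff₀ hx', ← h2]
    exact ⟨fun h => h.2, fun h => ⟨h1, h⟩⟩

lemma sqrt_mul_lt_iff {σ b r s : ℝ} (hσ : σ ∈ Ioc (0 : ℝ) 1) (hr : 0 ≤ r) (hs : 0 ≤ s)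
    (h : s ^ 2 = b ^ 2 + r ^ 2) :
    Real.sqrt (1 - σ ^ 2) * s < b ↔ Real.sqrt (1 - σ ^ 2) / σ * r < b := by
  obtain ⟨h0, h1⟩ := hσ
  have hq := Real.sq_sqrt (show 0 ≤ 1 - σ ^ 2 by nlinarith)
  have hq0 := Real.sqrt_nonneg (1 - σ ^ 2)
  set q := Real.sqrt (1 - σ ^ 2)
  rw [div_mul_eq_mul_div, div_lt_iff₀ h0]
  constructor
  · intro hlt
    have hb : 0 < b := lt_of_le_of_lt (by positivity) hlt
    have h2 := pow_lt_pow_left₀ hlt (by positivity) two_ne_zero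
    refine lt_of_pow_lt_pow_left₀ 2 (by positivity) ?_
    rw [mul_pow, mul_pow] at *
    nlinarith
  · intro hlt
    have hb : 0 < b := by
      by_contra hb
      have : 0 ≤ q * r := by positivity
      nlinarith
    have h2 := pow_lt_pow_left₀ hlt (by positivity) two_ne_zero
    refine lt_of_pow_lt_pow_left₀ 2 (by positivity) ?_
    rw [mul_pow, mul_pow] at *
    nlinarith

lemma mem_cone_iff {a : EuclideanSpace ℝ (Fin (n + 1))} (ha : ‖a‖ = 1)
    {σ : ℝ} (hσ : σ ∈ Ioc (0 : ℝ) 1) {m : ℕ}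
    {ι : EuclideanSpace ℝ (Fin m) →ₗᵢ[ℝ] EuclideanSpace ℝ (Fin (n + 1))} (hι : ∀ w, ⟪a, ι w⟫ = 0)
    (b : ℝ) (w : EuclideanSpace ℝ (Fin m)) :
    b • a + ι w ∈ normalize ⁻¹' cap n a σ ↔ Real.sqrt (1 - σ ^ 2) / σ * ‖w‖ < b := by
  have h1 : ⟪b • a + ι w, a⟫ = b := by
    rw [inner_add_left, real_inner_smul_left, real_inner_self_eq_norm_sq, ha, real_inner_comm, hι]
    ring
  have h2 : ‖b • a + ι w‖ ^ 2 = b ^ 2 + ‖w‖ ^ 2 := by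
    rw [norm_add_sq_real, real_inner_smul_left, hι, norm_smul, ha, ι.norm_map, Real.norm_eq_abs,
      mul_one, sq_abs]
    ring
  rw [mem_preimage_cap_iff, h1, sqrt_mul_lt_iff hσ (norm_nonneg w) (norm_nonneg _) h2]

lemma lintegral_Ioi_mul_exp {c : ℝ} (hc : 0 ≤ c) :
    ∫⁻ ρ in Ioi c, ENNReal.ofReal (ρ * rexp (-π * ρ ^ 2)) =
      ENNReal.ofReal (rexp (-π * c ^ 2) / (2 * π)) := by
  have hd : ∀ x ∈ Ici c, HasDerivAt (fun ρ => -(rexp (-π * ρ ^ 2) / (2 * π)))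
      (x * rexp (-π * x ^ 2)) x := by
    intro x _
    refine ((((hasDerivAt_pow 2 x).const_mul (-π)).exp.div_const (2 * π)).fun_neg).congr_deriv ?_
    have := Real.pi_ne_zero
    push_cast
    field_simp
  have hpos : ∀ x ∈ Ioi c, 0 ≤ x * rexp (-π * x ^ 2) := fun x hx =>
    mul_nonneg (hc.trans (le_of_lt hx)) (Real.exp_pos _).le
  have hlim : Filter.Tendsto (fun ρ => -(rexp (-π * ρ ^ 2) / (2 * π))) Filter.atTop (nhds 0) := by
    have h1 : Filter.Tendsto (fun ρ : ℝ => -π * ρ ^ 2) Filter.atTop Filter.atBot :=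
      (Filter.tendsto_pow_atTop two_ne_zero).const_mul_atTop_of_neg (neg_lt_zero.2 Real.pi_pos)
    simpa using ((Real.tendsto_exp_atBot.comp h1).div_const (2 * π)).neg
  have hi := integrableOn_Ioi_deriv_of_nonneg' hd hpos hlim
  rw [← ofReal_integral_eq_lintegral_ofReal hi
    ((ae_restrict_iff' measurableSet_Ioi).2 (Filter.Eventually.of_forall hpos)),
    integral_Ioi_of_hasDerivAt_of_nonneg' hd hpos hlim]
  congr 1
  ring

/-- The Gaussian average of a Gaussian function of the distance to a line. -/
lemma lintegral_gauss_exp_dist_line {m : ℕ} {y : EuclideanSpace ℝ (Fin (m + 1))} (hy : y ≠ 0)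
    {σ : ℝ} (hσ : σ ∈ Ioc (0 : ℝ) 1) :
    ∫⁻ x, ENNReal.ofReal (rexp (-π * (Real.sqrt (1 - σ ^ 2) / σ *
      Metric.infDist x (Submodule.span ℝ {y})) ^ 2)) ∂gauss (EuclideanSpace ℝ (Fin (m + 1))) ≤
    ENNReal.ofReal (σ ^ m) := by
  obtain ⟨h0, h1⟩ := hσ
  have hq := Real.sq_sqrt (show 0 ≤ 1 - σ ^ 2 by nlinarith)
  have hy' : 0 < ‖y‖ := norm_pos_iff.2 hy
  obtain ⟨ι, hι, hmp⟩ := exists_split (E := EuclideanSpace ℝ (Fin (m + 1))) (m := m)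
    (finrank_euclideanSpace_fin) (norm_normalize hy)
  rw [← hmp.lintegral_comp (by fun_prop)]
  calc _ ≤ ∫⁻ p : ℝ × EuclideanSpace ℝ (Fin m),
      ENNReal.ofReal (rexp (-(π * (Real.sqrt (1 - σ ^ 2) / σ) ^ 2) * ‖p.2‖ ^ 2))
        ∂(gauss ℝ).prod (gauss _) := by
        refine lintegral_mono fun p => ENNReal.ofReal_le_ofReal (Real.exp_le_exp.2 ?_)
        have hd : ‖p.2‖ ≤ Metric.infDist (p.1 • normalize y + ι p.2) (Submodule.span ℝ {y}) := by
          refine (Metric.le_infDist ⟨0, zero_mem _⟩).2 fun z hz => ?_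
          obtain ⟨c, rfl⟩ := Submodule.mem_span_singleton.1 hz
          have h3 : p.1 • normalize y + ι p.2 - c • y = (p.1 - c * ‖y‖) • normalize y + ι p.2 := by
            have : c • y = (c * ‖y‖) • normalize y := by
              rw [normalize, smul_smul, mul_assoc, mul_inv_cancel₀ hy'.ne', mul_one]
            rw [this]
            module
          rw [dist_eq_norm, h3]
          refine le_of_sq_le_sq ?_ (norm_nonneg _)
          rw [norm_add_sq_real, real_inner_smul_left, hι, ι.norm_map]
          nlinarith [sq_nonneg ‖(p.1 - c * ‖y‖) • normalize y‖]
        have hd2 := pow_le_pow_left₀ (norm_nonneg p.2) hd 2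
        rw [mul_pow, neg_mul, neg_mul, neg_le_neg_iff, mul_assoc]
        gcongr
    _ = ∫⁻ w : EuclideanSpace ℝ (Fin m),
        ENNReal.ofReal (rexp (-(π * (Real.sqrt (1 - σ ^ 2) / σ) ^ 2) * ‖w‖ ^ 2)) ∂gauss _ := by
        rw [lintegral_prod _ (by fun_prop)]
        simp only [lintegral_const, measure_univ, mul_one]
    _ = ENNReal.ofReal (σ ^ m) := by
        rw [lintegral_gauss_exp (by positivity), finrank_euclideanSpace_fin]
        congr 1
        rw [div_pow, hq, show (1 + (1 - σ ^ 2) / σ ^ 2)⁻¹ = σ ^ 2 by field_simp; ring,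
          ← Real.rpow_natCast, ← Real.rpow_mul h0.le, ← Real.rpow_natCast]
        congr 1
        push_cast
        ring

lemma exists_trig_cone {m : ℕ} {τ ρ α : ℝ} (hτ : 0 ≤ τ) (hρ : 0 < ρ) (hα : α ∈ Ioo (-π) π)
    {x y : EuclideanSpace ℝ (Fin m)}
    (h : τ * ‖Real.cos α • x - Real.sin α • y‖ < ρ * Real.cos α) :
    α ∈ Ioo (-(π / 2)) (π / 2) ∧ τ * Metric.infDist x (Submodule.span ℝ {y}) < ρ := by
  have hc : 0 < Real.cos α := by
    have : 0 ≤ τ * ‖Real.cos α • x - Real.sin α • y‖ := by positivity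
    exact (pos_iff_pos_of_mul_pos (this.trans_lt h)).1 hρ
  refine ⟨?_, ?_⟩
  · by_contra hcon
    rw [mem_Ioo, not_and_or, not_lt, not_lt] at hcon
    rcases hcon with hcon | hcon
    · have := Real.cos_nonpos_of_pi_div_two_le_of_le (x := -α) (by linarith)
        (by linarith [hα.1, Real.pi_pos])
      rw [Real.cos_neg] at this
      linarith
    · have := Real.cos_nonpos_of_pi_div_two_le_of_le hcon (by linarith [hα.2, Real.pi_pos])
      linarith
  · have h1 : Metric.infDist x (Submodule.span ℝ {y}) ≤
        ‖Real.cos α • x - Real.sin α • y‖ / Real.cos α := by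
      refine (Metric.infDist_le_dist_of_mem (Submodule.mem_span_singleton.2
        ⟨Real.sin α / Real.cos α, rfl⟩)).trans_eq ?_
      rw [dist_eq_norm, eq_div_iff hc.ne', mul_comm]
      nth_rw 1 [← abs_of_pos hc]
      rw [← Real.norm_eq_abs, ← norm_smul, smul_sub, smul_smul, mul_div_cancel₀ _ hc.ne']
    calc _ ≤ τ * (‖Real.cos α • x - Real.sin α • y‖ / Real.cos α) := by gcongr
      _ < ρ := by rwa [← mul_div_assoc, div_lt_iff₀ hc]

/-- Upper bound for the mean of `zeroPotential` over a spherical cone. -/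
lemma setLIntegral_cone_zeroPotential_le {m k : ℕ} {P : MvPolynomial (Fin (m + 1 + 1)) ℝ}
    (hP : P.IsHomogeneous k) {R : ℝ} (hR : 0 < R) (hR1 : R ≤ 1)
    {a : EuclideanSpace ℝ (Fin (m + 1 + 1))} (ha : ‖a‖ = 1) {σ : ℝ} (hσ : σ ∈ Ioc (0 : ℝ) 1) :
    ∫⁻ x in normalize ⁻¹' cap (m + 1) a σ,
      ∫⁻ y : EuclideanSpace ℝ (Fin (m + 1 + 1)), zeroPotential P k R x.ofLp y.ofLp
        ∂gauss _ ∂gauss _ ≤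
    (k * ENNReal.ofReal (2 * R)) * (ENNReal.ofReal (2 * π)⁻¹ * ENNReal.ofReal (σ ^ m)) := by
  set B : Set (EuclideanSpace ℝ (Fin (m + 1 + 1))) := normalize ⁻¹' cap (m + 1) a σ with hB
  set τ := Real.sqrt (1 - σ ^ 2) / σ with hτ
  have hτ0 : 0 ≤ τ := div_nonneg (Real.sqrt_nonneg _) hσ.1.le
  have hBm : MeasurableSet B := measurable_normalize (measurableSet_cap a σ)
  obtain ⟨ι, hι, hmp⟩ := exists_split (E := EuclideanSpace ℝ (Fin (m + 1 + 1))) (m := m + 1)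
    finrank_euclideanSpace_fin ha
  have hZ : Measurable fun q : EuclideanSpace ℝ (Fin (m + 1 + 1)) ×
      EuclideanSpace ℝ (Fin (m + 1 + 1)) => zeroPotential P k R q.1.ofLp q.2.ofLp :=
    measurable_zeroPotential (Ω := EuclideanSpace ℝ (Fin (m + 1 + 1)) ×
      EuclideanSpace ℝ (Fin (m + 1 + 1))) (x := fun q => q.1.ofLp) (y := fun q => q.2.ofLp) P k R
      (fun i => by exact (measurable_ofLp_apply i).comp measurable_fst)
      (fun i => by exact (measurable_ofLp_apply i).comp measurable_snd)
  set H : EuclideanSpace ℝ (Fin (m + 1 + 1)) × EuclideanSpace ℝ (Fin (m + 1 + 1)) → ℝ≥0∞ :=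
    (B ×ˢ univ).indicator fun q => zeroPotential P k R q.1.ofLp q.2.ofLp with hHdef
  have hH : Measurable H := hZ.indicator (hBm.prod MeasurableSet.univ)
  have h1 : ∫⁻ x in B, ∫⁻ y : EuclideanSpace ℝ (Fin (m + 1 + 1)),
        zeroPotential P k R x.ofLp y.ofLp ∂gauss _ ∂gauss _ =
      ∫⁻ x : EuclideanSpace ℝ (Fin (m + 1 + 1)),
        ∫⁻ y : EuclideanSpace ℝ (Fin (m + 1 + 1)), H (x, y) ∂gauss _ ∂gauss _ := by
    rw [← lintegral_indicator hBm]
    refine lintegral_congr fun x => ?_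
    by_cases hx : x ∈ B <;> simp [H, hx]
  rw [h1, lintegral_gauss_pair hmp hH]
  have hinner : ∀ x' y' : EuclideanSpace ℝ (Fin (m + 1)), ∀ ρ ∈ Ioi (0 : ℝ),
      ∫⁻ α in Ioo (-π) π, ENNReal.ofReal (ρ * rexp (-π * ρ ^ 2)) *
        H (Real.cos α • (ρ • a + ι x') - Real.sin α • ι y',
            Real.sin α • (ρ • a + ι x') + Real.cos α • ι y') ≤
      (Ioi (τ * Metric.infDist x' (Submodule.span ℝ {y'}))).indicator (fun ρ =>
        ENNReal.ofReal (ρ * rexp (-π * ρ ^ 2)) * (k * ENNReal.ofReal (2 * R))) ρ := by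
    intro x' y' ρ hρ
    have hmem : ∀ α ∈ Ioo (-π) π, Real.cos α • (ρ • a + ι x') - Real.sin α • ι y' ∈ B →
        α ∈ Ioo (-(π / 2)) (π / 2) ∧ τ * Metric.infDist x' (Submodule.span ℝ {y'}) < ρ := by
      intro α hα h
      have : Real.cos α • (ρ • a + ι x') - Real.sin α • ι y' =
          (ρ * Real.cos α) • a + ι (Real.cos α • x' - Real.sin α • y') := by
        rw [map_sub, map_smul, map_smul]
        module
      rw [this, hB, mem_cone_iff ha hσ hι] at h
      exact exists_trig_cone hτ0 hρ hα h
    by_cases hlt : τ * Metric.infDist x' (Submodule.span ℝ {y'}) < ρ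
    · rw [indicator_of_mem (mem_Ioi.2 hlt), lintegral_const_mul' _ _ ENNReal.ofReal_ne_top]
      gcongr
      calc _ ≤ ∫⁻ α in Ioo (-π) π, (Ioo (-(π / 2)) (π / 2)).indicator (fun α =>
            zeroPotential P k R
              (fun i => Real.cos α * (ρ • a + ι x').ofLp i - Real.sin α * (ι y').ofLp i)
              (fun i => Real.sin α * (ρ • a + ι x').ofLp i + Real.cos α * (ι y').ofLp i)) α := by
            refine setLIntegral_mono' measurableSet_Ioo fun α hα => ?_
            by_cases hx : Real.cos α • (ρ • a + ι x') - Real.sin α • ι y' ∈ B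
            · rw [indicator_of_mem (hmem α hα hx).1, hHdef,
                indicator_of_mem (mem_prod.2 ⟨hx, mem_univ _⟩)]
              exact le_of_eq rfl
            · rw [hHdef, indicator_of_notMem (fun h => hx (mem_prod.1 h).1)]
              exact zero_le
        _ ≤ ∫⁻ α, (Ioo (-(π / 2)) (π / 2)).indicator (fun α =>
            zeroPotential P k R
              (fun i => Real.cos α * (ρ • a + ι x').ofLp i - Real.sin α * (ι y').ofLp i)
              (fun i => Real.sin α * (ρ • a + ι x').ofLp i + Real.cos α * (ι y').ofLp i)) α :=
            setLIntegral_le_lintegral _ _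
        _ ≤ _ := by
            rw [lintegral_indicator measurableSet_Ioo]
            exact lintegral_zeroPotential_le hP hR hR1 _ _
    · rw [setLIntegral_congr_fun (g := fun _ => 0) measurableSet_Ioo, lintegral_zero]
      · exact zero_le
      · intro α hα
        have hx : Real.cos α • (ρ • a + ι x') - Real.sin α • ι y' ∉ B :=
          fun h => hlt (hmem α hα h).2
        simp only [hHdef]
        rw [indicator_of_notMem (fun h => hx (mem_prod.1 h).1), mul_zero]
  calc _ ≤ ∫⁻ y' : EuclideanSpace ℝ (Fin (m + 1)), ∫⁻ x' : EuclideanSpace ℝ (Fin (m + 1)),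
        (k * ENNReal.ofReal (2 * R)) * (ENNReal.ofReal (2 * π)⁻¹ *
        ENNReal.ofReal (rexp (-π * (τ * Metric.infDist x' (Submodule.span ℝ {y'})) ^ 2)))
        ∂gauss _ ∂gauss _ := by
        refine lintegral_mono fun y' => lintegral_mono fun x' => ?_
        refine (setLIntegral_mono' measurableSet_Ioi (hinner x' y')).trans ?_
        rw [setLIntegral_indicator measurableSet_Ioi, inter_eq_self_of_subset_left
          (Ioi_subset_Ioi (mul_nonneg hτ0 Metric.infDist_nonneg)),
          lintegral_mul_const _ (by fun_prop),
          lintegral_Ioi_mul_exp (mul_nonneg hτ0 Metric.infDist_nonneg), mul_comm,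
          ← ENNReal.ofReal_mul (by positivity), div_eq_inv_mul]
    _ ≤ ∫⁻ _ : EuclideanSpace ℝ (Fin (m + 1)), (k * ENNReal.ofReal (2 * R)) * (ENNReal.ofReal (2 * π)⁻¹ *
        ENNReal.ofReal (σ ^ m)) ∂gauss _ := by
        refine lintegral_mono_ae ?_
        filter_upwards [ae_gauss_ne_zero] with y' hy'
        rw [lintegral_const_mul _ (by fun_prop), lintegral_const_mul _ (by fun_prop)]
        gcongr
        exact lintegral_gauss_exp_dist_line hy' hσ
    _ = _ := by rw [lintegral_const, measure_univ, mul_one]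

end UpperBound

section ConeMeasure

variable {n : ℕ}

lemma le_gauss_Ioi {c l : ℝ} (hl : 0 < l) :
    ENNReal.ofReal (rexp (-(π * (1 + l⁻¹)) * c ^ 2) * (1 / (2 * Real.sqrt (1 + l)))) ≤
      gauss ℝ (Ioi c) := by
  have hpre : (fun b : ℝ => b + c) ⁻¹' Ioi c = Ioi 0 := by
    ext b; simp
  have hint : ∫⁻ b in Ioi (0 : ℝ), ENNReal.ofReal (rexp (-(π * (1 + l)) * b ^ 2)) =
      ENNReal.ofReal (1 / (2 * Real.sqrt (1 + l))) := by
    rw [← ofReal_integral_eq_lintegral_ofReal, integral_gaussian_Ioi, div_mul_eq_div_div,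
      div_self Real.pi_ne_zero, Real.sqrt_div zero_le_one, Real.sqrt_one]
    · congr 1
      field_simp
    · exact (integrable_exp_neg_mul_sq (by positivity)).integrableOn
    · exact Filter.Eventually.of_forall fun b => (Real.exp_pos _).le
  rw [gauss, withDensity_apply _ measurableSet_Ioi,
    ← (measurePreserving_add_right volume c).setLIntegral_comp_preimage measurableSet_Ioi
      measurable_gaussDensity, hpre, ENNReal.ofReal_mul (Real.exp_pos _).le, ← hint,
    ← lintegral_const_mul _ (by fun_prop)]
  refine lintegral_mono fun b => ?_
  rw [← ENNReal.ofReal_mul (Real.exp_pos _).le, ← Real.exp_add, gaussDensity, Real.norm_eq_abs,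
    sq_abs]
  refine ENNReal.ofReal_le_ofReal (Real.exp_le_exp.2 ?_)
  have key : 2 * b * c ≤ l⁻¹ * c ^ 2 + l * b ^ 2 := by
    have : 0 ≤ l⁻¹ * (c - l * b) ^ 2 := by positivity
    have h2 : l⁻¹ * (c - l * b) ^ 2 = l⁻¹ * c ^ 2 - 2 * b * c + l * b ^ 2 := by
      field_simp
      ring
    linarith
  nlinarith [mul_le_mul_of_nonneg_left key Real.pi_pos.le]

/-- Lower bound for the Gaussian measure of a spherical cone. -/
lemma le_gauss_cone (hn : 1 ≤ n) {a : EuclideanSpace ℝ (Fin (n + 1))} (ha : ‖a‖ = 1) {σ : ℝ}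
    (hσ : σ ∈ Ioc (0 : ℝ) 1) :
    ENNReal.ofReal (rexp (-(1 / 2)) * σ ^ n / (2 * Real.sqrt (n + 1))) ≤
      gauss (EuclideanSpace ℝ (Fin (n + 1))) (normalize ⁻¹' cap n a σ) := by
  have hn0 : (0 : ℝ) < n := by exact_mod_cast hn
  have h0 := hσ.1
  have hq := Real.sq_sqrt (show 0 ≤ 1 - σ ^ 2 by nlinarith [hσ.2])
  obtain ⟨ι, hι, hmp⟩ := exists_split (E := EuclideanSpace ℝ (Fin (n + 1))) (m := n)
    finrank_euclideanSpace_fin ha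
  have hBm : MeasurableSet (normalize ⁻¹' cap n a σ) :=
    measurable_normalize (measurableSet_cap a σ)
  rw [← hmp.measure_preimage hBm.nullMeasurableSet,
    Measure.prod_apply_symm (hmp.measurable hBm)]
  set τ := Real.sqrt (1 - σ ^ 2) / σ with hτ
  have hτ0 : 0 ≤ τ := div_nonneg (Real.sqrt_nonneg _) h0.le
  have hτ2 : 1 + τ ^ 2 = (σ ^ 2)⁻¹ := by
    rw [hτ, div_pow, hq]
    field_simp
    ring
  calc ENNReal.ofReal (rexp (-(1 / 2)) * σ ^ n / (2 * Real.sqrt (n + 1)))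
      ≤ ENNReal.ofReal ((1 + (1 + (n : ℝ)⁻¹) * τ ^ 2)⁻¹ ^ (n / 2 : ℝ)) *
          ENNReal.ofReal (1 / (2 * Real.sqrt (1 + n))) := by
        rw [← ENNReal.ofReal_mul (by positivity)]
        refine ENNReal.ofReal_le_ofReal ?_
        rw [mul_one_div, add_comm (1 : ℝ) n]
        gcongr
        have h1 : 1 + (1 + (n : ℝ)⁻¹) * τ ^ 2 ≤ rexp ((n : ℝ)⁻¹) * (σ ^ 2)⁻¹ := by
          have h2 := Real.add_one_le_exp ((n : ℝ)⁻¹)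
          have h3 : 0 < (n : ℝ)⁻¹ := by positivity
          rw [← hτ2]
          nlinarith [sq_nonneg τ]
        have h4 : rexp (-(n : ℝ)⁻¹) * σ ^ 2 ≤ (1 + (1 + (n : ℝ)⁻¹) * τ ^ 2)⁻¹ := by
          have := inv_anti₀ (by positivity) h1
          rwa [mul_inv, inv_inv, ← Real.exp_neg] at this
        refine le_trans (le_of_eq ?_) (Real.rpow_le_rpow (by positivity) h4 (by positivity))
        rw [Real.mul_rpow (Real.exp_pos _).le (by positivity), ← Real.exp_mul,
          ← Real.rpow_natCast σ 2, ← Real.rpow_mul h0.le, ← Real.rpow_natCast]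
        congr 2
        · field_simp
        · push_cast
          ring
    _ = ∫⁻ w : EuclideanSpace ℝ (Fin n), ENNReal.ofReal
          (rexp (-(π * ((1 + (n : ℝ)⁻¹) * τ ^ 2)) * ‖w‖ ^ 2)) *
          ENNReal.ofReal (1 / (2 * Real.sqrt (1 + n))) ∂gauss _ := by
        rw [lintegral_mul_const _ (by fun_prop), lintegral_gauss_exp (by positivity),
          finrank_euclideanSpace_fin]
    _ ≤ _ := by
        refine lintegral_mono fun w => ?_
        have hset : (fun b => (b, w)) ⁻¹' ((fun p : ℝ × EuclideanSpace ℝ (Fin n) =>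
            p.1 • a + ι p.2) ⁻¹' (normalize ⁻¹' cap n a σ)) = Ioi (τ * ‖w‖) := by
          ext b
          exact mem_cone_iff ha hσ hι b w
        rw [hset, ← ENNReal.ofReal_mul (Real.exp_pos _).le]
        refine le_trans (le_of_eq ?_) (le_gauss_Ioi hn0)
        congr 3
        ring

end ConeMeasure

section Nonvanishing

variable {n : ℕ}

lemma ae_gauss_eval_ne_zero {P : MvPolynomial (Fin (n + 1)) ℝ} (hP : P ≠ 0) {k : ℕ}
    (hhom : P.IsHomogeneous k) :
    ∀ᵐ x ∂gauss (EuclideanSpace ℝ (Fin (n + 1))), MvPolynomial.eval x.ofLp P ≠ 0 := by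
  refine gauss_absolutelyContinuous.ae_le ?_
  obtain ⟨v, hv⟩ : ∃ v : Fin (n + 1) → ℝ, MvPolynomial.eval v P ≠ 0 := by
    by_contra! h
    exact hP (MvPolynomial.funext fun x => by simpa using h x)
  refine ae_mem_of_ae_add_linearMap_mem (𝕜 := ℝ)
    (LinearMap.toSpanSingleton ℝ _ (WithLp.toLp 2 v)) (volume : Measure ℝ) volume
    (s := {x | MvPolynomial.eval x.ofLp P ≠ 0}) ?_ fun y => ?_
  · exact (measurableSet_eq_fun (measurable_eval P fun i => measurable_ofLp_apply i)
      measurable_const).compl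
  · have hne : linePoly P v y.ofLp ≠ 0 := by
      intro h
      have := eval_linePoly P v y.ofLp 0
      simp [h] at this
      exact hv this.symm
    have hfin : ((linePoly P v y.ofLp).rootSet ℝ).Finite := Polynomial.rootSet_finite _ _
    have hcount : ({0} ∪ (fun s => s⁻¹) ⁻¹' ((linePoly P v y.ofLp).rootSet ℝ) : Set ℝ).Countable :=
      ((finite_singleton 0).union (hfin.preimage inv_injective.injOn)).countable
    filter_upwards [hcount.ae_notMem volume] with s hs
    simp only [mem_union, mem_singleton_iff, mem_preimage, not_or] at hs
    obtain ⟨hs0, hs1⟩ := hs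
    intro h0
    apply hs1
    rw [Polynomial.mem_rootSet]
    refine ⟨hne, ?_⟩
    rw [Polynomial.coe_aeval_eq_eval, eval_linePoly]
    have h1 := aeval_mul_of_isHomogeneous hhom s⁻¹ (fun i => y.ofLp i + s * v i)
    simp only [MvPolynomial.aeval_eq_eval] at h1
    have h2 : MvPolynomial.eval (fun i => y.ofLp i + s * v i) P = 0 := h0
    have h3 : (fun i => v i + s⁻¹ * y.ofLp i) = fun i => s⁻¹ * (y.ofLp i + s * v i) := by
      funext i
      field_simp
      ring
    rw [h3]
    exact h1.trans (by rw [h2, mul_zero])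

end Nonvanishing

section Assembly

variable {n : ℕ}

lemma one_le_lintegral_gauss_radial {m : ℝ} (hm : 0 < m) (hm2 : m ^ 2 = (n + 1) / (2 * π)) :
    1 ≤ ∫⁻ x : EuclideanSpace ℝ (Fin (n + 1)), ENNReal.ofReal (3 / 2 - ‖x‖ ^ 2 / (2 * m ^ 2))
      ∂gauss _ := by
  have h1 : ∫⁻ x : EuclideanSpace ℝ (Fin (n + 1)), ENNReal.ofReal (‖x‖ ^ 2 / (2 * m ^ 2))
      ∂gauss _ = ENNReal.ofReal (1 / 2) := by
    simp_rw [div_eq_mul_inv (_ ^ 2) (2 * m ^ 2)]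
    have h2 : ∀ x : EuclideanSpace ℝ (Fin (n + 1)),
        ENNReal.ofReal (‖x‖ ^ 2 * (2 * m ^ 2)⁻¹) =
          ENNReal.ofReal (‖x‖ ^ 2) * ENNReal.ofReal (2 * m ^ 2)⁻¹ := fun x =>
      ENNReal.ofReal_mul (by positivity)
    rw [lintegral_congr h2, lintegral_mul_const _ (by fun_prop), lintegral_gauss_sq_norm,
      finrank_euclideanSpace_fin, ← ENNReal.ofReal_mul (by positivity)]
    congr 1
    push_cast
    rw [← hm2]
    field_simp
  have h3 : ENNReal.ofReal (3 / 2) ≤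
      ∫⁻ x : EuclideanSpace ℝ (Fin (n + 1)), (ENNReal.ofReal (3 / 2 - ‖x‖ ^ 2 / (2 * m ^ 2)) +
        ENNReal.ofReal (‖x‖ ^ 2 / (2 * m ^ 2))) ∂gauss _ := by
    calc ENNReal.ofReal (3 / 2) = ∫⁻ x : EuclideanSpace ℝ (Fin (n + 1)), ENNReal.ofReal (3 / 2)
          ∂gauss _ := by rw [lintegral_const, measure_univ, mul_one]
      _ ≤ _ := by
        refine lintegral_mono fun x => ?_
        refine le_trans (ENNReal.ofReal_le_ofReal (le_of_eq ?_)) ENNReal.ofReal_add_le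
        ring
  rw [lintegral_add_left (by fun_prop), h1] at h3
  have h4 : ENNReal.ofReal (3 / 2) = 1 + ENNReal.ofReal (1 / 2) := by
    rw [← ENNReal.ofReal_one, ← ENNReal.ofReal_add (by norm_num) (by norm_num)]
    norm_num
  rw [h4] at h3
  exact (ENNReal.add_le_add_iff_right ENNReal.ofReal_ne_top).1 h3

variable {S : Set (EuclideanSpace ℝ (Fin (n + 1)))} {P : MvPolynomial (Fin (n + 1)) ℝ} {k : ℕ}

/-- Points whose direction is close to the zero set have a large mean `zeroPotential`. -/
lemma le_lintegral_zeroPotential_of_infDist_lt (hSne : S.Nonempty)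
    (hScone : ∀ x ∈ S, ∀ lam : ℝ, lam • x ∈ S) (hSP : ∀ x ∈ S, MvPolynomial.eval x.ofLp P = 0)
    {ε m R : ℝ} (hε : 0 < ε) (hm : 0 < m) (hR : R = 2 * rexp 2 * ε * m)
    {x : EuclideanSpace ℝ (Fin (n + 1))} (hx : MvPolynomial.eval x.ofLp P ≠ 0) (hx0 : x ≠ 0)
    (hdist : Metric.infDist (normalize x) S < ε) :
    ENNReal.ofReal (3 / 2 - ‖x‖ ^ 2 / (2 * m ^ 2)) ≤
      ∫⁻ y : EuclideanSpace ℝ (Fin (n + 1)), zeroPotential P k R x.ofLp y.ofLp ∂gauss _ := by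
  obtain ⟨p, hp, hpd⟩ := (Metric.infDist_lt_iff hSne).1 hdist
  have hr : 0 < ‖x‖ := norm_pos_iff.2 hx0
  have hw : MvPolynomial.eval (x + (‖x‖ • p - x)).ofLp P = 0 := by
    rw [add_sub_cancel]
    exact hSP _ (hScone p hp _)
  refine le_trans (ENNReal.ofReal_le_ofReal ?_) (le_lintegral_zeroPotential hx hw)
  have hw0 : ‖x‖ • p - x ≠ 0 := by
    intro h
    rw [h, add_zero] at hw
    exact hx hw
  have hlt : ‖‖x‖ • p - x‖ < ‖x‖ * ε := by
    have : ‖x‖ • p - x = ‖x‖ • (p - normalize x) := by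
      rw [normalize, smul_sub, smul_smul, mul_inv_cancel₀ hr.ne', one_smul]
    rw [this, norm_smul, norm_norm, ← dist_eq_norm, dist_comm]
    exact mul_lt_mul_of_pos_left hpd hr
  have hlog := Real.log_lt_log (norm_pos_iff.2 hw0) hlt
  rw [Real.log_mul hr.ne' hε.ne'] at hlog
  have hlogR : Real.log R = Real.log 2 + 2 + Real.log ε + Real.log m := by
    rw [hR, Real.log_mul (by positivity) hm.ne', Real.log_mul (by positivity) hε.ne',
      Real.log_mul (by norm_num) (Real.exp_pos _).ne', Real.log_exp]
  have hq := Real.log_le_sub_one_of_pos (show 0 < ‖x‖ ^ 2 / m ^ 2 by positivity)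
  rw [Real.log_div (by positivity) (by positivity), Real.log_pow, Real.log_pow] at hq
  have hq2 : ‖x‖ ^ 2 / (2 * m ^ 2) = ‖x‖ ^ 2 / m ^ 2 / 2 := by field_simp
  rw [hlogR, hq2]
  push_cast at hq
  linarith

lemma gauss_cone_inter_le_lintegral (hSne : S.Nonempty)
    (hScone : ∀ x ∈ S, ∀ lam : ℝ, lam • x ∈ S) (hSP : ∀ x ∈ S, MvPolynomial.eval x.ofLp P = 0)
    (hP : P ≠ 0) (hhom : P.IsHomogeneous k) {ε m R : ℝ} (hε : 0 < ε) (hm : 0 < m)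
    (hm2 : m ^ 2 = (n + 1) / (2 * π)) (hR : R = 2 * rexp 2 * ε * m)
    (a : EuclideanSpace ℝ (Fin (n + 1))) (σ : ℝ) :
    gauss (EuclideanSpace ℝ (Fin (n + 1)))
        (normalize ⁻¹' ({z | Metric.infDist z S < ε} ∩ cap n a σ)) ≤
      ∫⁻ x in normalize ⁻¹' cap n a σ,
        ∫⁻ y : EuclideanSpace ℝ (Fin (n + 1)), zeroPotential P k R x.ofLp y.ofLp
          ∂gauss _ ∂gauss _ := by
  have hT : MeasurableSet {z | Metric.infDist z S < ε} :=
    measurableSet_lt (Metric.continuous_infDist_pt S).measurable measurable_const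
  have hTB := hT.inter (measurableSet_cap a σ)
  calc gauss (EuclideanSpace ℝ (Fin (n + 1)))
        (normalize ⁻¹' ({z | Metric.infDist z S < ε} ∩ cap n a σ))
      ≤ gauss (EuclideanSpace ℝ (Fin (n + 1)))
        (normalize ⁻¹' ({z | Metric.infDist z S < ε} ∩ cap n a σ)) *
        ∫⁻ x : EuclideanSpace ℝ (Fin (n + 1)), ENNReal.ofReal (3 / 2 - ‖x‖ ^ 2 / (2 * m ^ 2))
          ∂gauss _ := le_mul_of_one_le_right' (one_le_lintegral_gauss_radial hm hm2)
    _ = ∫⁻ x in normalize ⁻¹' ({z | Metric.infDist z S < ε} ∩ cap n a σ),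
          ENNReal.ofReal (3 / 2 - ‖x‖ ^ 2 / (2 * m ^ 2)) ∂gauss _ := by
        refine (setLIntegral_gauss_radial (f := fun r => ENNReal.ofReal (3 / 2 - r ^ 2 / (2 * m ^ 2)))
          (C := ENNReal.ofReal (3 / 2)) (by fun_prop) ENNReal.ofReal_ne_top (fun r => ?_) hTB).symm
        refine ENNReal.ofReal_le_ofReal (sub_le_self _ (by positivity))
    _ ≤ ∫⁻ x in normalize ⁻¹' ({z | Metric.infDist z S < ε} ∩ cap n a σ),
          ∫⁻ y : EuclideanSpace ℝ (Fin (n + 1)), zeroPotential P k R x.ofLp y.ofLp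
          ∂gauss _ ∂gauss _ := by
        refine lintegral_mono_ae ?_
        filter_upwards [ae_restrict_mem (measurable_normalize hTB),
          ae_restrict_of_ae (ae_gauss_eval_ne_zero hP hhom), ae_restrict_of_ae ae_gauss_ne_zero]
          with x hx hxP hx0
        exact le_lintegral_zeroPotential_of_infDist_lt hSne hScone hSP hε hm hR hxP hx0 hx.1
    _ ≤ _ := lintegral_mono_set (preimage_mono inter_subset_right)

lemma mean_bound_numerics : 16 * rexp 5 ≤ (13 / 2) ^ 2 * (2 * π ^ 3) := by
  have h1 := Real.exp_one_lt_d9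
  have h2 := Real.pi_gt_d4
  have h3 : rexp 5 = rexp 1 ^ 5 := by
    rw [← Real.exp_nat_mul]
    norm_num
  have h4 : rexp 1 ^ 5 ≤ 2.7182818286 ^ 5 := pow_le_pow_left₀ (Real.exp_pos _).le h1.le 5
  have h5 : (3.1415 : ℝ) ^ 3 ≤ π ^ 3 := pow_le_pow_left₀ (by norm_num) h2.le 3
  rw [h3]
  nlinarith [h4, h5]

lemma mean_bound_le_cap_bound {N d k σ ε q s : ℝ} (hN : 1 ≤ N) (hk0 : 0 ≤ k) (hkd : k ≤ d)
    (hε : 0 < ε) (hσ : 0 < σ) (hq : 0 < q) (hq2 : q ^ 2 = N + 1) (hs : 0 < s)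
    (hs2 : s ^ 2 = 2 * π) (i : ℕ) :
    k * (2 * (2 * rexp 2 * ε * (q / s))) * ((2 * π)⁻¹ * σ ^ i) ≤
      13 * d * N / σ * ε * (rexp (-(1 / 2)) * σ ^ (i + 1) / (2 * q)) := by
  have hπ := Real.pi_pos
  have hnum : 4 * (rexp 2 * rexp (1 / 2)) ≤ 13 / 2 * (s * π) := by
    refine le_of_sq_le_sq ?_ (by positivity)
    have h1 : (4 * (rexp 2 * rexp (1 / 2))) ^ 2 = 16 * rexp 5 := by
      rw [← Real.exp_add, mul_pow, ← Real.exp_nat_mul]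
      norm_num
    have h2 : (13 / 2 * (s * π)) ^ 2 = (13 / 2) ^ 2 * (2 * π ^ 3) := by
      rw [mul_pow, mul_pow, hs2]
      ring
    rw [h1, h2]
    exact mean_bound_numerics
  have hd0 : 0 ≤ d := hk0.trans hkd
  have h3 : k * q ^ 2 ≤ d * (2 * N) := by
    rw [hq2]
    exact mul_le_mul hkd (by linarith) (by linarith) hd0
  have h4 : k * q ^ 2 * (4 * (rexp 2 * rexp (1 / 2))) ≤ d * (2 * N) * (13 / 2 * (s * π)) :=
    mul_le_mul h3 hnum (by positivity) (by positivity)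
  have hL : k * (2 * (2 * rexp 2 * ε * (q / s))) * ((2 * π)⁻¹ * σ ^ i) =
      k * q ^ 2 * (4 * (rexp 2 * rexp (1 / 2))) *
        (ε * σ ^ i / (2 * q * s * π * rexp (1 / 2))) := by
    field_simp
    ring
  have hR : 13 * d * N / σ * ε * (rexp (-(1 / 2)) * σ ^ (i + 1) / (2 * q)) =
      d * (2 * N) * (13 / 2 * (s * π)) * (ε * σ ^ i / (2 * q * s * π * rexp (1 / 2))) := by
    rw [Real.exp_neg]
    field_simp
    ring
  rw [hL, hR]
  gcongr

end Assembly
end ConicCondition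

open ConicCondition

/-- For `t ≥ ln((2d+1)n/σ)`, the event `ln C(z) > t` (i.e. `dist(z,S) < e^{-t}`,
which also covers the ill-posed case `dist(z,S) = 0`) has `ν_{a,σ}`-probability at
most `(13dn/σ)·e^{-t}`. -/
theorem stmt16 (n d : ℕ) (hn : 1 ≤ n) (hd : 1 ≤ d)
    (S : Set (EuclideanSpace ℝ (Fin (n + 1)))) (hSne : S.Nonempty) (hScl : IsClosed S)
    (hScone : ∀ x ∈ S, ∀ lam : ℝ, lam • x ∈ S)
    (P : MvPolynomial (Fin (n + 1)) ℝ) (hP : P ≠ 0)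
    (k : ℕ) (hk : k ≤ d) (hhom : P.IsHomogeneous k)
    (hSP : ∀ x ∈ S, MvPolynomial.eval (fun i => x i) P = 0)
    (σ : ℝ) (hσ : σ ∈ Set.Ioc (0:ℝ) 1)
    (a : EuclideanSpace ℝ (Fin (n + 1)))
    (ha : a ∈ Metric.sphere (0 : EuclideanSpace ℝ (Fin (n + 1))) 1)
    (t : ℝ) (ht : Real.log ((2 * d + 1) * n / σ) ≤ t) :
    nuMeasure n a σ {z | Metric.infDist z S < Real.exp (-t)} ≤
      ENNReal.ofReal (13 * d * n / σ * Real.exp (-t)) := by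
  have ha1 : ‖a‖ = 1 := by simpa using ha
  have hσ0 := hσ.1
  have hT : MeasurableSet {z | Metric.infDist z S < Real.exp (-t)} :=
    measurableSet_lt (Metric.continuous_infDist_pt S).measurable measurable_const
  refine nuMeasure_le_of_gauss_le ha1 hσ hT ?_
  rcases le_or_gt 1 (13 * d * n / σ * Real.exp (-t)) with hbig | hsmall
  · exact (measure_mono (Set.preimage_mono Set.inter_subset_right)).trans
      (le_mul_of_one_le_left' (ENNReal.one_le_ofReal.2 hbig))
  set ε := Real.exp (-t) with hεdef
  have hε : 0 < ε := Real.exp_pos _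
  have hπ := Real.pi_pos
  have hn1 : (1 : ℝ) ≤ n := by exact_mod_cast hn
  have hd1 : (1 : ℝ) ≤ d := by exact_mod_cast hd
  have hq : 0 < Real.sqrt (n + 1) := Real.sqrt_pos.2 (by positivity)
  have hq2 : Real.sqrt (n + 1) ^ 2 = (n : ℝ) + 1 := Real.sq_sqrt (by positivity)
  have hs : 0 < Real.sqrt (2 * Real.pi) := Real.sqrt_pos.2 (by positivity)
  have hs2 : Real.sqrt (2 * Real.pi) ^ 2 = 2 * Real.pi := Real.sq_sqrt (by positivity)
  set m := Real.sqrt (n + 1) / Real.sqrt (2 * Real.pi) with hmdef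
  have hm : 0 < m := div_pos hq hs
  have hm2 : m ^ 2 = (n + 1) / (2 * Real.pi) := by rw [hmdef, div_pow, hq2, hs2]
  have hR : 0 < 2 * Real.exp 2 * ε * m := by positivity
  have hR1 : 2 * Real.exp 2 * ε * m ≤ 1 := by
    have hmn : m ≤ 3 / 5 * n := by
      refine le_of_sq_le_sq ?_ (by positivity)
      rw [hm2, div_le_iff₀ (by positivity)]
      nlinarith [Real.pi_gt_three]
    have hnε : 13 * (n * ε) ≤ 1 := by
      have h1 : 13 * d * n / σ * ε = 13 * d * n * ε / σ := by ring
      rw [h1, div_lt_one hσ0] at hsmall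
      have h2 : 13 * (n * ε) ≤ 13 * d * n * ε := by
        have : 0 < n * ε := by positivity
        nlinarith
      linarith [hσ.2]
    have he : Real.exp 2 ≤ 10 := by
      have h1 := Real.exp_one_lt_d9
      have h2 : Real.exp 2 = Real.exp 1 ^ 2 := by
        rw [← Real.exp_nat_mul]
        norm_num
      rw [h2]
      nlinarith [Real.exp_pos 1]
    calc 2 * Real.exp 2 * ε * m ≤ 2 * 10 * ε * (3 / 5 * n) := by gcongr
      _ ≤ 1 := by linarith
  obtain ⟨i, rfl⟩ : ∃ i, n = i + 1 := ⟨n - 1, by omega⟩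
  calc _ ≤ _ := gauss_cone_inter_le_lintegral hSne hScone hSP hP hhom hε hm hm2 rfl a σ
    _ ≤ _ := setLIntegral_cone_zeroPotential_le hhom hR hR1 ha1 hσ
    _ ≤ ENNReal.ofReal (13 * d * ((i + 1 : ℕ) : ℝ) / σ * ε) * ENNReal.ofReal
        (Real.exp (-(1 / 2)) * σ ^ (i + 1) / (2 * Real.sqrt (((i + 1 : ℕ) : ℝ) + 1))) := by
      rw [← ENNReal.ofReal_natCast k, ← ENNReal.ofReal_mul (by positivity),
        ← ENNReal.ofReal_mul (by positivity), ← ENNReal.ofReal_mul (by positivity),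
        ← ENNReal.ofReal_mul (by positivity)]
      exact ENNReal.ofReal_le_ofReal (mean_bound_le_cap_bound hn1 (by positivity)
        (by exact_mod_cast hk) hε hσ0 hq hq2 hs hs2 i)
    _ ≤ _ := by
      gcongr
      exact le_gauss_cone hn ha1 hσ
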